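/- arXiv:1903.07921 — 2 statements merged into one kernel-verified Lean document; each statement's English description precedes it below -/
import Mathlib

section
/- Let S ⊆ R be a Frobenius extension of rings which is either free (R is free of finite rank as a left S-module) or left-split; in particular any Frobenius extension with S a commutative ring is left-split. Then fdd(R) = fdd(S) and domdim(R) = domdim(S). -/
/-!
Statement 1: If `S ⊆ R` is a Frobenius extension of rings which is free (i.e. `R` is free
of finite rank as a left `S`-module) or left-split (in particular if `S` is commutative),
then `fdd(R) = fdd(S)` and `domdim(R) = domdim(S)`.
-/

universe u
open MulOpposite
/-- `domdimGE R n M` holds iff there is an exact sequence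
`0 → M → I^0 → ⋯ → I^(n-1)` of left `R`-modules in which every `I^j` is both
projective and injective; i.e. the dominant dimension of `M` is at least `n`. -/
def domdimGE (R : Type u) [Ring R] :
    ℕ → (M : Type u) → [AddCommGroup M] → [Module R M] → Prop
  | 0, _, _, _ => True
  | (n+1), M, iM, mM =>
      letI := iM; letI := mM
      ∃ (I : Type u) (_ : AddCommGroup I) (_ : Module R I),
        Module.Projective R I ∧ Module.Injective R I ∧
        ∃ f : M →ₗ[R] I, Function.Injective f ∧ domdimGE R n (I ⧸ LinearMap.range f)
/-- The subgroup of "balanced relations" in `M ⊗[ℤ] X`, for `M` a right `R`-module and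
`X` a left `R`-module.  The quotient of `M ⊗[ℤ] X` by this subgroup is the tensor product
`M ⊗_R X` over the (possibly noncommutative) ring `R`. -/
def balRel (R : Type u) [Ring R] (M : Type u) [AddCommGroup M] [Module Rᵐᵒᵖ M]
    (X : Type u) [AddCommGroup X] [Module R X] : Submodule ℤ (TensorProduct ℤ M X) :=
  Submodule.span ℤ
    {z | ∃ (m : M) (r : R) (x : X), z = m ⊗ₜ[ℤ] (r • x) - ((op r) • m) ⊗ₜ[ℤ] x}

/-- Scalar multiplication `I ⊗[ℤ] F → F`, `i ⊗ v ↦ i • v`, for a right ideal `I` of `R`. -/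
noncomputable def idealSmul (R : Type u) [Ring R] (F : Type u) [AddCommGroup F] [Module R F]
    (I : Submodule Rᵐᵒᵖ R) : TensorProduct ℤ (↥I) F →ₗ[ℤ] F :=
  TensorProduct.lift (AddMonoidHom.toIntLinearMap
    { toFun := fun i => AddMonoidHom.toIntLinearMap
        { toFun := fun v => (i : R) • v
          map_zero' := smul_zero _
          map_add' := fun v w => smul_add _ _ _ }
      map_zero' := by ext v; simp
      map_add' := fun i j => by ext v; simp [add_smul] })

/-- A left module `F` over a (possibly noncommutative) ring `R` is flat if for every
finitely generated right ideal `I` of `R` the canonical map `I ⊗_R F → F` is injective.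
Since `I ⊗_R F` is the quotient of `I ⊗[ℤ] F` by the balanced relations (all of which are
killed by `idealSmul`), this injectivity says exactly that the kernel of `idealSmul`
is contained in the subgroup of balanced relations. -/
def ModFlat (R : Type u) [Ring R] (F : Type u) [AddCommGroup F] [Module R F] : Prop :=
  ∀ I : Submodule Rᵐᵒᵖ R, I.FG →
    LinearMap.ker (idealSmul R F I) ≤ balRel R (↥I) F

/-- `fddGE R n M` holds iff there is an exact sequence
`0 → M → I^0 → ⋯ → I^(n-1)` of left `R`-modules in which every `I^j` is both
flat and injective; i.e. the (left) flat-dominant dimension of `M` is at least `n`. -/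
def fddGE (R : Type u) [Ring R] :
    ℕ → (M : Type u) → [AddCommGroup M] → [Module R M] → Prop
  | 0, _, _, _ => True
  | (n+1), M, iM, mM =>
      letI := iM; letI := mM
      ∃ (I : Type u) (_ : AddCommGroup I) (_ : Module R I),
        ModFlat R I ∧ Module.Injective R I ∧
        ∃ f : M →ₗ[R] I, Function.Injective f ∧ fddGE R n (I ⧸ LinearMap.range f)
section FrobeniusExtension

variable {R : Type u} [Ring R] (S : Subring R)

/-- Right multiplication by `r : R` on `R`, as a map of left `S`-modules. -/
def mulRightS (r : R) : R →ₗ[↥S] R where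
  toFun x := x * r
  map_add' x y := add_mul x y r
  map_smul' s x := by
    show (s : R) * x * r = (s : R) * (x * r)
    rw [mul_assoc]

/-- A subring `S ⊆ R` is a Frobenius extension if `R` is finitely generated projective as
a left `S`-module and `R ≅ Hom_S(R, S)` as `R`-`S`-bimodules.  Here the left `R`-action on
`Hom_S(R, S)` is `(r • f) y = f (y * r)` and the right `S`-action is `(f • s) y = f y * s`,
so the two compatibility conditions below express exactly that the additive isomorphism
`e` is an isomorphism of `R`-`S`-bimodules. -/
def IsFrobeniusExtension : Prop :=
  Module.Finite ↥S R ∧ Module.Projective ↥S R ∧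
  ∃ e : R ≃+ (R →ₗ[↥S] ↥S),
    (∀ (r x : R), e (r * x) = e x ∘ₗ mulRightS S r) ∧
    (∀ (s : ↥S) (x : R), e (x * (s : R)) = LinearMap.toSpanSingleton ↥S ↥S s ∘ₗ e x)

/-- The extension `S ⊆ R` is left-split if the inclusion is a split monomorphism of left
`S`-modules. -/
def IsLeftSplitExtension : Prop :=
  ∃ π : R →ₗ[↥S] ↥S, ∀ s : ↥S, π (s : R) = s

end FrobeniusExtension

/-- `HasCoresolution R C n M` says that there is an exact sequence
`0 → M → I^0 → ⋯ → I^(n-1)` of left `R`-modules in which every `I^j` is injective and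
satisfies `C`. -/
inductive HasCoresolution (R : Type u) [Ring R]
    (C : ∀ (I : Type u) [AddCommGroup I] [Module R I], Prop) :
    ℕ → ∀ (M : Type u) [AddCommGroup M] [Module R M], Prop
  | zero (M : Type u) [AddCommGroup M] [Module R M] : HasCoresolution R C 0 M
  | succ {n : ℕ} {M I Q : Type u} [AddCommGroup M] [Module R M] [AddCommGroup I] [Module R I]
      [AddCommGroup Q] [Module R Q] (hC : C I) (hI : Module.Injective R I)
      (f : M →ₗ[R] I) (g : I →ₗ[R] Q) (hf : Function.Injective f)
      (hg : Function.Surjective g) (hfg : Function.Exact f g)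
      (hQ : HasCoresolution R C n Q) : HasCoresolution R C (n + 1) M

section Coresolution

variable {R : Type u} [Ring R] {C : ∀ (I : Type u) [AddCommGroup I] [Module R I], Prop}

lemma HasCoresolution.of_equiv {n : ℕ} {M N : Type u} [AddCommGroup M] [Module R M]
    [AddCommGroup N] [Module R N] (e : M ≃ₗ[R] N) (h : HasCoresolution R C n M) :
    HasCoresolution R C n N := by
  cases h with
  | zero => exact .zero N
  | succ hC hI f g hf hg hfg hQ =>
    refine .succ hC hI (f ∘ₗ e.symm.toLinearMap) g (hf.comp e.symm.injective) hg ?_ hQ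
    intro y
    rw [hfg y]
    constructor
    · rintro ⟨x, rfl⟩
      exact ⟨e x, by simp⟩
    · rintro ⟨x, rfl⟩
      exact ⟨e.symm x, by simp⟩

lemma hasCoresolution_succ_iff {n : ℕ} {M : Type u} [AddCommGroup M] [Module R M] :
    HasCoresolution R C (n + 1) M ↔
      ∃ (I : Type u) (_ : AddCommGroup I) (_ : Module R I), C I ∧ Module.Injective R I ∧
        ∃ f : M →ₗ[R] I, Function.Injective f ∧
          HasCoresolution R C n (I ⧸ LinearMap.range f) := by
  constructor
  · intro h
    cases h with
    | succ hC hI f g hf hg hfg hQ =>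
      refine ⟨_, _, _, hC, hI, f, hf, hQ.of_equiv ?_⟩
      exact ((Submodule.quotEquivOfEq _ _ hfg.linearMap_ker_eq.symm).trans
        (g.quotKerEquivOfSurjective hg)).symm
  · rintro ⟨I, _, _, hC, hI, f, hf, hQ⟩
    exact .succ hC hI f (LinearMap.range f).mkQ hf (Submodule.mkQ_surjective _)
      (LinearMap.exact_map_mkQ_range f) hQ

lemma injective_prod {I J : Type u} [AddCommGroup I] [Module R I] [AddCommGroup J]
    [Module R J] (hI : Module.Injective R I) (hJ : Module.Injective R J) :
    Module.Injective R (I × J) where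
  out X Y _ _ _ _ i hi f := by
    obtain ⟨g, hg⟩ := hI.out i hi (LinearMap.fst R I J ∘ₗ f)
    obtain ⟨h, hh⟩ := hJ.out i hi (LinearMap.snd R I J ∘ₗ f)
    exact ⟨g.prod h, fun x ↦ Prod.ext (hg x) (hh x)⟩

lemma HasCoresolution.prod_injective
    (hprod : ∀ (I J : Type u) [AddCommGroup I] [Module R I] [AddCommGroup J] [Module R J],
      C I → C J → C (I × J))
    {n : ℕ} {M J : Type u} [AddCommGroup M] [Module R M] [AddCommGroup J] [Module R J]
    (hM : HasCoresolution R C n M) (hCJ : C J) (hJ : Module.Injective R J) :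
    HasCoresolution R C n (M × J) := by
  cases hM with
  | zero => exact .zero _
  | @succ n _ I Q _ _ _ _ _ _ hC hI f g hf hg hfg hQ =>
    refine .succ (hprod I J hC hCJ) (injective_prod hI hJ) (f.prodMap LinearMap.id)
      (g ∘ₗ LinearMap.fst R I J) ?_ ?_ ?_ hQ
    · exact hf.prodMap Function.injective_id
    · exact hg.comp Prod.fst_surjective
    · rintro ⟨y, z⟩
      refine (hfg y).trans ⟨?_, ?_⟩
      · rintro ⟨x, rfl⟩
        exact ⟨(x, z), rfl⟩
      · rintro ⟨⟨x, w⟩, h⟩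
        exact ⟨x, congrArg Prod.fst h⟩

/-- Admitting a coresolution of length `n` passes to direct summands. -/
lemma HasCoresolution.of_retract
    (hprod : ∀ (I J : Type u) [AddCommGroup I] [Module R I] [AddCommGroup J] [Module R J],
      C I → C J → C (I × J))
    {n : ℕ} {X M : Type u} [AddCommGroup M] [Module R M] [AddCommGroup X] [Module R X]
    (hX : HasCoresolution R C n X) (i : M →ₗ[R] X) (p : X →ₗ[R] M) (hpi : ∀ m, p (i m) = m) :
    HasCoresolution R C n M := by
  induction n generalizing X M with
  | zero => exact .zero M
  | succ n ih =>
    cases hX with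
    | @succ _ _ I Q _ _ _ _ _ _ hC hI f g hf hg hfg hQ =>
      obtain ⟨P, hP⟩ := hI.out f hf (f ∘ₗ i ∘ₗ p)
      have hP' : ∀ x, P (f x) = f (i (p x)) := hP
      have hinj : Function.Injective (f ∘ₗ i) :=
        hf.comp (Function.LeftInverse.injective hpi)
      let N := LinearMap.range (f ∘ₗ i)
      have hker : LinearMap.ker g ≤ LinearMap.ker (N.mkQ ∘ₗ P) := by
        intro a ha
        obtain ⟨x, rfl⟩ := (hfg a).1 ha
        simp only [LinearMap.mem_ker, LinearMap.comp_apply, hP', Submodule.mkQ_apply,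
          Submodule.Quotient.mk_eq_zero]
        exact ⟨p x, rfl⟩
      let α : (I ⧸ N) →ₗ[R] Q × I := N.liftQ (g.prod (LinearMap.id - P)) (by
        rintro _ ⟨m, rfl⟩
        simp [hP', hpi, hfg.apply_apply_eq_zero])
      let β₁ : Q →ₗ[R] I ⧸ N :=
        (LinearMap.ker g).liftQ (N.mkQ ∘ₗ P) hker ∘ₗ
          (g.quotKerEquivOfSurjective hg).symm.toLinearMap
      have hβ₁ : ∀ a, β₁ (g a) = N.mkQ (P a) := by
        intro a
        have : (g.quotKerEquivOfSurjective hg).symm (g a) = Submodule.Quotient.mk a := by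
          rw [LinearEquiv.symm_apply_eq]; rfl
        simp only [β₁, LinearMap.comp_apply, LinearEquiv.coe_coe, this]
        rfl
      refine hasCoresolution_succ_iff.2 ⟨I, _, _, hC, hI, f ∘ₗ i, hinj,
        ih (hQ.prod_injective hprod hC hI) α (β₁.coprod N.mkQ) ?_⟩
      intro a
      obtain ⟨a, rfl⟩ := N.mkQ_surjective a
      have : α (N.mkQ a) = (g a, a - P a) := rfl
      rw [this, LinearMap.coprod_apply, hβ₁, ← map_add, add_sub_cancel]

lemma domdimGE_iff_hasCoresolution (n : ℕ) (M : Type u) [AddCommGroup M] [Module R M] :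
    domdimGE R n M ↔ HasCoresolution R (fun I _ _ ↦ Module.Projective R I) n M := by
  induction n generalizing M with
  | zero => exact ⟨fun _ ↦ .zero M, fun _ ↦ trivial⟩
  | succ n ih =>
    rw [hasCoresolution_succ_iff]
    simp only [domdimGE, ih]

end Coresolution

/-- The equational criterion for flatness: every linear relation in `F` is a consequence of
relations in `R`. -/
def EquationallyFlat (R : Type u) [Ring R] (F : Type u) [AddCommGroup F] [Module R F] : Prop :=
  ∀ (ι : Type) [Fintype ι] (a : ι → R) (m : ι → F), ∑ i, a i • m i = 0 →
    ∃ (κ : Type) (_ : Fintype κ) (b : ι → κ → R) (n : κ → F),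
      (∀ i, m i = ∑ k, b i k • n k) ∧ ∀ k, ∑ i, a i * b i k = 0

section Flat

variable {R : Type u} [Ring R]

lemma exists_eq_sum_tmul {A B : Type u} [AddCommGroup A] [AddCommGroup B]
    (z : TensorProduct ℤ A B) :
    ∃ (ι : Type) (_ : Fintype ι) (a : ι → A) (b : ι → B), z = ∑ i, a i ⊗ₜ[ℤ] b i := by
  induction z with
  | zero => exact ⟨Empty, inferInstance, Empty.elim, Empty.elim, by simp⟩
  | tmul a b => exact ⟨Unit, inferInstance, fun _ ↦ a, fun _ ↦ b, by simp⟩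
  | add x y hx hy =>
    obtain ⟨ι, _, a, b, rfl⟩ := hx
    obtain ⟨κ, _, c, d, rfl⟩ := hy
    exact ⟨ι ⊕ κ, inferInstance, Sum.elim a c, Sum.elim b d, by simp⟩

@[simp]
lemma idealSmul_tmul {F : Type u} [AddCommGroup F] [Module R F] (I : Submodule Rᵐᵒᵖ R)
    (i : I) (v : F) : idealSmul R F I (i ⊗ₜ[ℤ] v) = (i : R) • v := rfl

lemma EquationallyFlat.modFlat {F : Type u} [AddCommGroup F] [Module R F]
    (h : EquationallyFlat R F) : ModFlat R F := by
  intro I _ z hz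
  obtain ⟨ι, _, a, m, rfl⟩ := exists_eq_sum_tmul z
  have hz' : ∑ i, (a i : R) • m i = 0 := by simpa using hz
  obtain ⟨κ, _, b, n, hm, hab⟩ := h ι (fun i ↦ (a i : R)) m hz'
  have hsum : ∀ k, ∑ i, op (b i k) • a i = 0 := by
    intro k
    ext
    simpa using hab k
  have hzero : ∑ i, ∑ k, (op (b i k) • a i) ⊗ₜ[ℤ] n k = 0 := by
    rw [Finset.sum_comm]
    simp [← TensorProduct.sum_tmul, hsum]
  have : ∑ i, a i ⊗ₜ[ℤ] m i =
      ∑ i, ∑ k, (a i ⊗ₜ[ℤ] (b i k • n k) - (op (b i k) • a i) ⊗ₜ[ℤ] n k) := by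
    simp only [Finset.sum_sub_distrib, hzero, sub_zero, ← TensorProduct.tmul_sum, ← hm]
  rw [this]
  exact Submodule.sum_mem _ fun i _ ↦ Submodule.sum_mem _ fun k _ ↦
    Submodule.subset_span ⟨a i, b i k, n k, rfl⟩

/-- The tuples in `ι → F` of the form `∑ k, b k • n k`, where each tuple `b k` of
coefficients satisfies the relation `a`. -/
def consequences {ι : Type} [Fintype ι] (a : ι → R) (F : Type u) [AddCommGroup F] [Module R F] :
    AddSubgroup (ι → F) :=
  AddSubgroup.closure {m | ∃ (b : ι → R) (n : F), ∑ i, a i * b i = 0 ∧ m = fun i ↦ b i • n}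

lemma exists_of_mem_consequences {ι : Type} [Fintype ι] {a : ι → R} {F : Type u}
    [AddCommGroup F] [Module R F] {m : ι → F} (hm : m ∈ consequences a F) :
    ∃ (κ : Type) (_ : Fintype κ) (b : ι → κ → R) (n : κ → F),
      (∀ i, m i = ∑ k, b i k • n k) ∧ ∀ k, ∑ i, a i * b i k = 0 := by
  induction hm using AddSubgroup.closure_induction with
  | mem m hm =>
    obtain ⟨b, n, hb, rfl⟩ := hm
    exact ⟨Unit, inferInstance, fun i _ ↦ b i, fun _ ↦ n, by simp, by simpa using hb⟩
  | zero => exact ⟨Empty, inferInstance, fun _ ↦ Empty.elim, Empty.elim, by simp, by simp⟩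
  | add x y _ _ hx hy =>
    obtain ⟨κ, _, b, n, hx, hb⟩ := hx
    obtain ⟨μ, _, c, p, hy, hc⟩ := hy
    refine ⟨κ ⊕ μ, inferInstance, fun i ↦ Sum.elim (b i) (c i), Sum.elim n p, ?_, ?_⟩
    · intro i
      simp [hx, hy]
    · rintro (k | k)
      · exact hb k
      · exact hc k
  | neg x _ hx =>
    obtain ⟨κ, _, b, n, hx, hb⟩ := hx
    refine ⟨κ, inferInstance, b, fun k ↦ -n k, ?_, hb⟩
    intro i
    simp [hx]

lemma ModFlat.equationallyFlat {F : Type u} [AddCommGroup F] [Module R F]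
    (h : ModFlat R F) : EquationallyFlat R F := by
  classical
  intro ι _ a m ham
  apply exists_of_mem_consequences
  let I : Submodule Rᵐᵒᵖ R := Submodule.span Rᵐᵒᵖ (Set.range a)
  have hI : ∀ x : I, ∃ b : ι → R, ∑ i, a i * b i = x := by
    rintro ⟨x, hx⟩
    obtain ⟨c, hc⟩ := (Submodule.mem_span_range_iff_exists_fun Rᵐᵒᵖ).1 hx
    exact ⟨fun i ↦ unop (c i), by simpa using hc⟩
  choose c hc using hI
  let N := consequences a F
  have key : ∀ (b b' : ι → R) (v : F), ∑ i, a i * b i = ∑ i, a i * b' i →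
      (QuotientAddGroup.mk (fun i ↦ b i • v) : (ι → F) ⧸ N) =
        QuotientAddGroup.mk (fun i ↦ b' i • v) := by
    intro b b' v hbb
    rw [QuotientAddGroup.eq]
    refine AddSubgroup.subset_closure ⟨b' - b, v, ?_, ?_⟩
    · simp [mul_sub, hbb]
    · ext i
      simp [sub_smul, neg_add_eq_sub]
  let ψ : TensorProduct ℤ I F →ₗ[ℤ] (ι → F) ⧸ N :=
    TensorProduct.lift (AddMonoidHom.toIntLinearMap
      { toFun := fun x ↦ AddMonoidHom.toIntLinearMap
          { toFun := fun v ↦ QuotientAddGroup.mk (fun i ↦ c x i • v)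
            map_zero' := by simp only [smul_zero]; rfl
            map_add' := fun v w ↦ by
              rw [← QuotientAddGroup.mk_add]
              congr 1
              ext i
              simp }
        map_zero' := by
          ext v
          refine (key (c 0) 0 v (by simp [hc])).trans ?_
          simp only [Pi.zero_apply, zero_smul]; rfl
        map_add' := fun x y ↦ by
          ext v
          refine (key (c (x + y)) (c x + c y) v
            (by simp [hc, mul_add, Finset.sum_add_distrib])).trans ?_
          simp only [Pi.add_apply, add_smul]; rfl })
  have hψ : ∀ (x : I) (b : ι → R) (v : F), ∑ i, a i * b i = x →
      ψ (x ⊗ₜ[ℤ] v) = QuotientAddGroup.mk (fun i ↦ b i • v) := fun x b v hb ↦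
    key (c x) b v ((hc x).trans hb.symm)
  have hbal : balRel R I F ≤ LinearMap.ker ψ := by
    refine Submodule.span_le.2 ?_
    rintro _ ⟨x, r, v, rfl⟩
    simp only [SetLike.mem_coe, LinearMap.mem_ker, map_sub]
    rw [hψ x (c x) (r • v) (hc x), hψ (op r • x) (fun i ↦ c x i * r) v]
    · simp [mul_smul]
    · simp [← mul_assoc, ← Finset.sum_mul, hc]
  let e : ι → I := fun i ↦ ⟨a i, Submodule.subset_span ⟨i, rfl⟩⟩
  have hz : ∑ i, e i ⊗ₜ[ℤ] m i ∈ LinearMap.ker (idealSmul R F I) := by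
    simpa [e] using ham
  have h0 : ψ (∑ i, e i ⊗ₜ[ℤ] m i) = 0 :=
    hbal (h I (Submodule.fg_span (Set.finite_range a)) hz)
  rw [map_sum] at h0
  have : ∀ i, ψ (e i ⊗ₜ[ℤ] m i) = QuotientAddGroup.mk' N (Pi.single i (m i)) := by
    intro i
    rw [hψ (e i) (Pi.single i 1) (m i) (by simp [e, Pi.single_apply])]
    refine congrArg _ (funext fun j ↦ ?_)
    by_cases hj : j = i
    · subst hj; simp
    · simp [hj]
  simp only [this, ← map_sum, Finset.univ_sum_single] at h0
  exact (QuotientAddGroup.eq_zero_iff m).1 h0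

lemma modFlat_iff_equationallyFlat {F : Type u} [AddCommGroup F] [Module R F] :
    ModFlat R F ↔ EquationallyFlat R F :=
  ⟨ModFlat.equationallyFlat, EquationallyFlat.modFlat⟩

lemma fddGE_iff_hasCoresolution (n : ℕ) (M : Type u) [AddCommGroup M] [Module R M] :
    fddGE R n M ↔ HasCoresolution R (fun I _ _ ↦ EquationallyFlat R I) n M := by
  induction n generalizing M with
  | zero => exact ⟨fun _ ↦ .zero M, fun _ ↦ trivial⟩
  | succ n ih =>
    rw [hasCoresolution_succ_iff]
    simp only [fddGE, ih, modFlat_iff_equationallyFlat]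

lemma EquationallyFlat.prod {F G : Type u} [AddCommGroup F] [Module R F] [AddCommGroup G]
    [Module R G] (hF : EquationallyFlat R F) (hG : EquationallyFlat R G) :
    EquationallyFlat R (F × G) := by
  intro ι _ a m ham
  obtain ⟨κ, _, b, n, hm, hab⟩ := hF ι a (fun i ↦ (m i).1) (by
    simpa [Prod.fst_sum] using congrArg Prod.fst ham)
  obtain ⟨μ, _, c, p, hm', hac⟩ := hG ι a (fun i ↦ (m i).2) (by
    simpa [Prod.snd_sum] using congrArg Prod.snd ham)
  refine ⟨κ ⊕ μ, inferInstance, fun i ↦ Sum.elim (b i) (c i),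
    Sum.elim (fun k ↦ (n k, 0)) (fun k ↦ (0, p k)), ?_, ?_⟩
  · intro i
    ext <;> simp [Prod.fst_sum, Prod.snd_sum, hm, hm']
  · rintro (k | k)
    · exact hab k
    · exact hac k

/-- In a flat module, finitely many linear relations on the same tuple are simultaneously
consequences of relations in the ring. -/
lemma EquationallyFlat.exists_of_forall {F : Type u} [AddCommGroup F] [Module R F]
    (hF : EquationallyFlat R F) {ι τ : Type} [Fintype ι] [Fintype τ] (a : τ → ι → R)
    (m : ι → F) (ham : ∀ t, ∑ i, a t i • m i = 0) :
    ∃ (κ : Type) (_ : Fintype κ) (b : ι → κ → R) (n : κ → F),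
      (∀ i, m i = ∑ k, b i k • n k) ∧ ∀ t k, ∑ i, a t i * b i k = 0 := by
  classical
  suffices H : ∀ T : Finset τ, ∃ (κ : Type) (_ : Fintype κ) (b : ι → κ → R) (n : κ → F),
      (∀ i, m i = ∑ k, b i k • n k) ∧ ∀ t ∈ T, ∀ k, ∑ i, a t i * b i k = 0 by
    obtain ⟨κ, hκ, b, n, hm, hab⟩ := H Finset.univ
    exact ⟨κ, hκ, b, n, hm, fun t ↦ hab t (Finset.mem_univ t)⟩
  intro T
  induction T using Finset.induction_on with
  | empty =>
    exact ⟨ι, inferInstance, fun i k ↦ if i = k then 1 else 0, m, by simp, by simp⟩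
  | insert t T _ ih =>
    obtain ⟨κ, _, b, n, hm, hab⟩ := ih
    obtain ⟨μ, _, c, p, hn, hc⟩ := hF κ (fun k ↦ ∑ i, a t i * b i k) n (by
      rw [← ham t]
      simp only [hm, Finset.sum_smul, Finset.smul_sum, mul_smul]
      exact Finset.sum_comm)
    have hassoc : ∀ s l, ∑ i, a s i * ∑ k, b i k * c k l = ∑ k, (∑ i, a s i * b i k) * c k l := by
      intro s l
      simp only [Finset.mul_sum, Finset.sum_mul, mul_assoc]
      exact Finset.sum_comm
    refine ⟨μ, inferInstance, fun i l ↦ ∑ k, b i k * c k l, p, ?_, ?_⟩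
    · intro i
      rw [hm i]
      simp only [hn, Finset.sum_smul, Finset.smul_sum, mul_smul]
      exact Finset.sum_comm
    · intro s hs l
      rw [hassoc]
      rcases Finset.mem_insert.1 hs with rfl | hs
      · exact hc l
      · simp [hab s hs]

end Flat

section Coinduced

variable {R : Type u} [Ring R] (S : Subring R)

/-- The left `R`-module `Hom_S(R, X)`, where `(r • φ) y = φ (y * r)`. -/
def Coinduced (X : Type u) [AddCommGroup X] [Module S X] : Type u := R →ₗ[S] X

variable {S} {X Y : Type u} [AddCommGroup X] [Module S X] [AddCommGroup Y] [Module S Y]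
  {M N : Type u} [AddCommGroup M] [Module R M] [AddCommGroup N] [Module R N]

namespace Coinduced

instance : AddCommGroup (Coinduced S X) := inferInstanceAs (AddCommGroup (R →ₗ[S] X))

instance : FunLike (Coinduced S X) R X := inferInstanceAs (FunLike (R →ₗ[S] X) R X)

instance : LinearMapClass (Coinduced S X) S R X :=
  inferInstanceAs (LinearMapClass (R →ₗ[S] X) S R X)

@[ext]
lemma ext {φ ψ : Coinduced S X} (h : ∀ r, φ r = ψ r) : φ = ψ := LinearMap.ext h

@[simp]
lemma add_apply (φ ψ : Coinduced S X) (r : R) : (φ + ψ) r = φ r + ψ r := rfl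

@[simp]
lemma zero_apply (r : R) : (0 : Coinduced S X) r = 0 := rfl

instance : SMul R (Coinduced S X) := ⟨fun r φ ↦ LinearMap.comp φ (mulRightS S r)⟩

@[simp]
lemma smul_apply (r : R) (φ : Coinduced S X) (y : R) : (r • φ) y = φ (y * r) := rfl

instance : Module R (Coinduced S X) where
  one_smul φ := by ext; simp
  mul_smul r t φ := by ext; simp [mul_assoc]
  smul_zero r := by ext; simp
  smul_add r φ ψ := by ext; simp
  add_smul r t φ := by ext; simp [mul_add]
  zero_smul φ := by ext; simp

@[simp]
lemma sum_apply {κ : Type} [Fintype κ] (φ : κ → Coinduced S X) (r : R) :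
    (∑ k, φ k) r = ∑ k, φ k r :=
  LinearMap.sum_apply _ _ _

lemma map_coe_mul (φ : Coinduced S X) (s : S) (r : R) : φ ((s : R) * r) = s • φ r :=
  map_smul φ s r

/-- Coinduction is functorial. -/
def map (f : X →ₗ[S] Y) : Coinduced S X →ₗ[R] Coinduced S Y where
  toFun φ := LinearMap.comp f φ
  map_add' φ ψ := by ext r; exact map_add f (φ r) (ψ r)
  map_smul' _ _ := rfl

@[simp]
lemma map_apply (f : X →ₗ[S] Y) (φ : Coinduced S X) (r : R) : map f φ r = f (φ r) := rfl

/-- Coinduction is right adjoint to restriction of scalars. -/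
def lift (f : M →ₗ[S] X) : M →ₗ[R] Coinduced S X where
  toFun m := f ∘ₗ (LinearMap.toSpanSingleton R M m).restrictScalars S
  map_add' m m' := by
    ext r
    exact (congrArg f (smul_add r m m')).trans (map_add f _ _)
  map_smul' t m := by
    ext r
    exact congrArg f (smul_smul r t m)

@[simp]
lemma lift_apply (f : M →ₗ[S] X) (m : M) (r : R) : lift f m r = f (r • m) := rfl

/-- Evaluation at `1`, the counit of the adjunction between restriction and coinduction. -/
def evalOne : Coinduced S X →ₗ[S] X where
  toFun φ := φ 1
  map_add' _ _ := rfl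
  map_smul' s φ := by
    rw [Subring.smul_def, smul_apply, one_mul, RingHom.id_apply, ← map_coe_mul, mul_one]

@[simp]
lemma evalOne_apply (φ : Coinduced S X) : evalOne φ = φ 1 := rfl

lemma injective (hX : Module.Injective S X) : Module.Injective R (Coinduced S X) where
  out A B _ _ _ _ i hi f := by
    obtain ⟨g, hg⟩ := hX.out (i.restrictScalars S) hi (evalOne ∘ₗ f.restrictScalars S)
    have hg' : ∀ a, g (i a) = f a 1 := hg
    refine ⟨lift g, fun a ↦ ?_⟩
    ext r
    rw [lift_apply, ← map_smul, hg', map_smul, smul_apply, one_mul]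

end Coinduced

/-- A Frobenius functional `E` together with a pair of dual bases `x`, `y`. -/
structure FrobeniusSystem (S : Subring R) (ι : Type) [Fintype ι] where
  E : R →ₗ[S] S
  x : ι → R
  y : ι → R
  E_mul_coe : ∀ (r : R) (s : S), E (r * s) = E r * s
  sum_E_mul : ∀ r, ∑ i, (E (r * x i) : R) * y i = r
  sum_mul_E : ∀ r, ∑ i, x i * (E (y i * r) : R) = r

lemma IsFrobeniusExtension.exists_frobeniusSystem (h : IsFrobeniusExtension S) :
    ∃ (n : ℕ), Nonempty (FrobeniusSystem S (Fin n)) := by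
  obtain ⟨hfin, hproj, e, he, he'⟩ := h
  obtain ⟨n, f, hf⟩ := Module.Finite.exists_fin' S R
  obtain ⟨g, hg⟩ := Module.projective_lifting_property f LinearMap.id hf
  have hE : ∀ r z, e r z = e 1 (z * r) := fun r z ↦ by
    conv_lhs => rw [← mul_one r, he]
    rfl
  have hEs : ∀ r (s : S), e 1 (r * s) = e 1 r * s := fun r s ↦ by
    rw [← hE, ← one_mul (s : R), he']
    rfl
  let x : Fin n → R := fun i ↦ e.symm (LinearMap.proj i ∘ₗ g)
  have hx : ∀ r i, e 1 (r * x i) = g r i := fun r i ↦ by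
    rw [← hE]
    simp [x]
  let y : Fin n → R := fun i ↦ f (Pi.single i 1)
  have hxy : ∀ r, ∑ i, (e 1 (r * x i) : R) * y i = r := fun r ↦ by
    have h1 : f (g r) = r := LinearMap.congr_fun hg r
    conv_rhs => rw [← h1, LinearMap.pi_apply_eq_sum_univ f (g r)]
    refine Finset.sum_congr rfl fun i _ ↦ ?_
    rw [hx, Subring.smul_def, smul_eq_mul]
    exact congrArg (fun v ↦ (g r i : R) * f v) (funext fun j ↦ by simp [Pi.single_apply, eq_comm])
  refine ⟨n, ⟨⟨e 1, x, y, hEs, hxy, fun r ↦ ?_⟩⟩⟩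
  apply e.injective
  ext z : 1
  rw [hE _ z, hE r z]
  conv_rhs => rw [← hxy z]
  simp only [Finset.mul_sum, Finset.sum_mul, map_sum, ← mul_assoc, hEs]
  refine Finset.sum_congr rfl fun i _ ↦ ?_
  rw [mul_assoc]
  exact (map_smul (e 1) (e 1 (z * x i)) (y i * r)).symm

namespace FrobeniusSystem

variable {ι : Type} [Fintype ι] (Z : FrobeniusSystem S ι)

lemma sum_E_smul (φ : Coinduced S X) (r : R) : ∑ i, Z.E (r * Z.x i) • φ (Z.y i) = φ r := by
  conv_rhs => rw [← Z.sum_E_mul r, map_sum]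
  simp only [Coinduced.map_coe_mul]

/-- The element of `Hom_S(R, X)` corresponding to `1 ⊗ v` under `Hom_S(R, X) ≅ R ⊗_S X`. -/
def unit : X →ₗ[S] Coinduced S X where
  toFun v := LinearMap.toSpanSingleton S X v ∘ₗ Z.E
  map_add' v w := by ext r; exact smul_add (Z.E r) v w
  map_smul' s v := by
    ext r
    change Z.E r • s • v = Z.E (r * s) • v
    rw [Z.E_mul_coe, mul_smul]

@[simp]
lemma unit_apply (v : X) (r : R) : Z.unit v r = Z.E r • v := rfl

lemma sum_smul_unit (φ : Coinduced S X) : ∑ i, Z.x i • Z.unit (φ (Z.y i)) = φ := by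
  ext r
  simp [Z.sum_E_smul]

/-- For a Frobenius extension, coinduction is also left adjoint to restriction of scalars. -/
def desc (f : X →ₗ[S] M) : Coinduced S X →ₗ[R] M where
  toFun φ := ∑ i, Z.x i • f (φ (Z.y i))
  map_add' φ ψ := by simp [Finset.sum_add_distrib]
  map_smul' r φ := by
    have : ∀ i, f (φ (Z.y i * r)) =
        ∑ j, (Z.E (Z.y i * (r * Z.x j)) : R) • f (φ (Z.y j)) := fun i ↦ by
      rw [← Z.sum_E_smul φ (Z.y i * r), map_sum]
      simp only [map_smul, Subring.smul_def, mul_assoc]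
    simp only [Coinduced.smul_apply, this, Finset.smul_sum, RingHom.id_apply]
    rw [Finset.sum_comm]
    refine Finset.sum_congr rfl fun j _ ↦ ?_
    simp only [smul_smul, ← Finset.sum_smul, Z.sum_mul_E]

lemma desc_apply (f : X →ₗ[S] M) (φ : Coinduced S X) :
    Z.desc f φ = ∑ i, Z.x i • f (φ (Z.y i)) := rfl

@[simp]
lemma desc_unit (f : X →ₗ[S] M) (v : X) : Z.desc f (Z.unit v) = f v := by
  have h1 : ∑ i, Z.x i * (Z.E (Z.y i) : R) = 1 := by simpa using Z.sum_mul_E 1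
  simp only [desc_apply, unit_apply, map_smul, Subring.smul_def, smul_smul, ← Finset.sum_smul,
    h1, one_smul]

include Z in
lemma injective_restrict (hM : Module.Injective R M) : Module.Injective S M where
  out A B _ _ _ _ i hi f := by
    obtain ⟨g, hg⟩ := hM.out (Coinduced.map i) (fun φ ψ h ↦ by
      ext r
      exact hi (DFunLike.congr_fun h r)) (Z.desc f)
    refine ⟨g.restrictScalars S ∘ₗ Z.unit, fun a ↦ ?_⟩
    have : Coinduced.map i (Z.unit a) = Z.unit (i a) := by
      ext r
      simp
    simpa [this] using hg (Z.unit a)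

include Z in
lemma map_surjective {f : X →ₗ[S] Y} (hf : Function.Surjective f) :
    Function.Surjective (Coinduced.map f) := by
  intro ψ
  choose v hv using fun i ↦ hf (ψ (Z.y i))
  refine ⟨∑ i, Z.x i • Z.unit (v i), ?_⟩
  conv_rhs => rw [← Z.sum_smul_unit ψ]
  ext r
  simp [hv]

include Z in
lemma projective_restrict (hM : Module.Projective R M) : Module.Projective S M := by
  refine .of_lifting_property fun {A B} _ _ _ _ p f hp ↦ ?_
  obtain ⟨h, hh⟩ := Module.projective_lifting_property (Coinduced.map p) (Coinduced.lift f)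
    (Z.map_surjective hp)
  refine ⟨Coinduced.evalOne ∘ₗ h.restrictScalars S, ?_⟩
  ext m
  simpa using DFunLike.congr_fun (LinearMap.congr_fun hh m) 1

include Z in
lemma equationallyFlat_restrict (hM : EquationallyFlat R M) : EquationallyFlat S M := by
  intro κ _ a m ham
  obtain ⟨μ, _, b, n, hm, hab⟩ := hM κ (fun i ↦ (a i : R)) m ham
  refine ⟨μ × ι, inferInstance, fun i l ↦ Z.E (b i l.1 * Z.x l.2),
    fun l ↦ Z.y l.2 • n l.1, ?_, ?_⟩
  · intro i
    simp only [Fintype.sum_prod_type, Subring.smul_def, smul_smul, ← Finset.sum_smul,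
      Z.sum_E_mul, hm]
  · rintro ⟨k, j⟩
    have : ∀ i, a i * Z.E (b i k * Z.x j) = Z.E (a i * b i k * Z.x j) := fun i ↦ by
      rw [mul_assoc]
      exact (map_smul Z.E (a i) (b i k * Z.x j)).symm
    simp only [this, ← map_sum, ← Finset.sum_mul, hab, zero_mul, map_zero]

include Z in
lemma projective_coinduced (hX : Module.Projective S X) :
    Module.Projective R (Coinduced S X) := by
  refine .of_lifting_property fun {A B} _ _ _ _ p f hp ↦ ?_
  obtain ⟨h, hh⟩ := Module.projective_lifting_property (p.restrictScalars S)
    (f.restrictScalars S ∘ₗ Z.unit) hp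
  have hh' : ∀ v, p (h v) = f (Z.unit v) := LinearMap.congr_fun hh
  refine ⟨Z.desc h, ?_⟩
  ext φ
  simp only [LinearMap.comp_apply, desc_apply, map_sum, map_smul, hh']
  simp only [← map_smul, ← map_sum, Z.sum_smul_unit]

include Z in
lemma equationallyFlat_coinduced (hX : EquationallyFlat S X) :
    EquationallyFlat R (Coinduced S X) := by
  intro κ _ a φ ha
  obtain ⟨μ, _, b, n, hm, hab⟩ := hX.exists_of_forall
    (fun (k : ι) (i : κ × ι) ↦ Z.E (Z.y k * a i.1 * Z.x i.2)) (fun i ↦ φ i.1 (Z.y i.2)) (by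
      intro k
      simp only [Fintype.sum_prod_type, Z.sum_E_smul]
      simpa using DFunLike.congr_fun ha (Z.y k))
  refine ⟨μ, inferInstance, fun i l ↦ ∑ j, Z.x j * b (i, j) l, fun l ↦ Z.unit (n l), ?_, ?_⟩
  · intro i
    conv_lhs => rw [← Z.sum_smul_unit (φ i)]
    have : ∀ j, Z.unit (φ i (Z.y j)) = ∑ l, (b (i, j) l : R) • Z.unit (n l) := fun j ↦ by
      rw [hm (i, j), map_sum]
      simp only [map_smul, Subring.smul_def]
    simp only [this, Finset.smul_sum, Finset.sum_smul, mul_smul]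
    exact Finset.sum_comm
  · intro l
    have hk : ∀ k, Z.E (Z.y k * ∑ i, a i * ∑ j, Z.x j * (b (i, j) l : R)) = 0 := fun k ↦ by
      rw [← hab k l, Fintype.sum_prod_type]
      simp only [Finset.mul_sum, ← mul_assoc, map_sum, Z.E_mul_coe]
    rw [← Z.sum_mul_E (∑ i, a i * ∑ j, Z.x j * (b (i, j) l : R))]
    simp [hk]

/-- For a Frobenius extension, `R ≅ Hom_S(R, S)` as left `R`-modules. -/
noncomputable def coinducedEquiv : Coinduced S S ≃ₗ[R] R :=
  (LinearEquiv.ofBijective (Coinduced.lift Z.E) (by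
    constructor
    · intro r t h
      rw [← Z.sum_mul_E r, ← Z.sum_mul_E t]
      have h' : ∀ z, Z.E (z * r) = Z.E (z * t) := DFunLike.congr_fun h
      simp only [h']
    · intro φ
      refine ⟨∑ i, Z.x i • (φ (Z.y i) : R), ?_⟩
      conv_rhs => rw [← Z.sum_smul_unit φ]
      rw [map_sum]
      refine Finset.sum_congr rfl fun i _ ↦ ?_
      rw [map_smul]
      congr 1
      ext r : 1
      exact Z.E_mul_coe r _)).symm

variable {C : ∀ (I : Type u) [AddCommGroup I] [Module R I], Prop}
  {D : ∀ (I : Type u) [AddCommGroup I] [Module S I], Prop}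

include Z in
lemma hasCoresolution_restrict
    (hCD : ∀ (I : Type u) [AddCommGroup I] [Module R I], C I → D I)
    {n : ℕ} (hM : HasCoresolution R C n M) : HasCoresolution S D n M := by
  induction hM with
  | zero M => exact .zero M
  | succ hC hI f g hf hg hfg _ ih =>
    exact .succ (hCD _ hC) (Z.injective_restrict hI) (f.restrictScalars S)
      (g.restrictScalars S) hf hg hfg ih

include Z in
lemma hasCoresolution_coinduced
    (hDC : ∀ (I : Type u) [AddCommGroup I] [Module S I], D I → C (Coinduced S I))
    {n : ℕ} (hX : HasCoresolution S D n X) : HasCoresolution R C n (Coinduced S X) := by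
  induction hX with
  | zero X => exact .zero _
  | succ hD hI f g hf hg hfg _ ih =>
    refine .succ (hDC _ hD) (Coinduced.injective hI) (Coinduced.map f) (Coinduced.map g)
      ?_ (Z.map_surjective hg) ?_ ih
    · intro φ ψ h
      ext r
      exact hf (DFunLike.congr_fun h r)
    · intro φ
      constructor
      · intro h
        choose v hv using fun i ↦ (hfg (φ (Z.y i))).1 (DFunLike.congr_fun h (Z.y i))
        refine ⟨∑ i, Z.x i • Z.unit (v i), ?_⟩
        conv_rhs => rw [← Z.sum_smul_unit φ]
        ext r
        simp [hv]
      · rintro ⟨φ, rfl⟩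
        ext r
        exact hfg.apply_apply_eq_zero (φ r)

include Z in
lemma hasCoresolution_iff
    (hCD : ∀ (I : Type u) [AddCommGroup I] [Module R I], C I → D I)
    (hDC : ∀ (I : Type u) [AddCommGroup I] [Module S I], D I → C (Coinduced S I))
    (hprod : ∀ (I J : Type u) [AddCommGroup I] [Module S I] [AddCommGroup J] [Module S J],
      D I → D J → D (I × J))
    (i : S →ₗ[S] R) (p : R →ₗ[S] S) (hpi : ∀ s, p (i s) = s) (n : ℕ) :
    HasCoresolution R C n R ↔ HasCoresolution S D n S :=
  ⟨fun h ↦ (Z.hasCoresolution_restrict hCD h).of_retract hprod i p hpi,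
    fun h ↦ (Z.hasCoresolution_coinduced hDC h).of_equiv Z.coinducedEquiv⟩

end FrobeniusSystem

/-- A Frobenius extension with commutative base ring is left-split. -/
lemma IsFrobeniusExtension.isLeftSplitExtension_of_comm (h : IsFrobeniusExtension S)
    (hcomm : ∀ a b : S, a * b = b * a) : IsLeftSplitExtension S := by
  obtain ⟨hfin, -, -⟩ := id h
  obtain ⟨n, ⟨Z⟩⟩ := h.exists_frobeniusSystem
  let _ : CommRing S := { (inferInstance : Ring S) with mul_comm := hcomm }
  let J : Ideal S := LinearMap.range Z.E
  have hJ : (⊤ : Submodule S R) ≤ J • ⊤ := fun r _ ↦ by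
    rw [← Z.sum_E_mul r]
    exact Submodule.sum_mem _ fun i _ ↦ Submodule.smul_mem_smul
      (LinearMap.mem_range_self Z.E _) (Submodule.mem_top (x := Z.y i))
  obtain ⟨s, hs, hs0⟩ := Submodule.exists_sub_one_mem_and_smul_eq_zero_of_fg_of_le_smul J
    (⊤ : Submodule S R) hfin.fg_top hJ
  have hs' : s = 0 := Subtype.ext (by
    simpa [Subring.smul_def] using hs0 1 Submodule.mem_top)
  obtain ⟨x, hx⟩ := J.neg_mem hs
  have hx' : Z.E x = 1 := by rw [hx, hs']; simp
  refine ⟨Z.E ∘ₗ mulRightS S x, fun t ↦ ?_⟩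
  have : Z.E ((t : R) * x) = t * Z.E x := map_smul Z.E t x
  exact this.trans (by rw [hx', mul_one])

/-- If `R` is free or left-split over `S`, then `S` is a direct summand of `R` as a left
`S`-module. -/
lemma IsFrobeniusExtension.exists_retract (h : IsFrobeniusExtension S)
    (hsplit : Module.Free S R ∨ IsLeftSplitExtension S ∨ (∀ a b : S, a * b = b * a)) :
    ∃ (i : S →ₗ[S] R) (p : R →ₗ[S] S), ∀ s, p (i s) = s := by
  have key : IsLeftSplitExtension S → ∃ (i : S →ₗ[S] R) (p : R →ₗ[S] S), ∀ s, p (i s) = s := by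
    rintro ⟨p, hp⟩
    exact ⟨LinearMap.toSpanSingleton S R 1, p, fun s ↦ by simpa [Subring.smul_def] using hp s⟩
  rcases hsplit with hfree | hsplit | hcomm
  · cases subsingleton_or_nontrivial R with
    | inl _ => exact ⟨0, 0, fun s ↦ Subsingleton.elim _ _⟩
    | inr _ =>
      let b := Module.Free.chooseBasis S R
      obtain ⟨j⟩ := b.index_nonempty
      exact ⟨LinearMap.toSpanSingleton S R (b j), b.coord j, fun s ↦ by simp⟩
  · exact key hsplit
  · exact key (h.isLeftSplitExtension_of_comm hcomm)

end Coinduced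

theorem stmt1 (R : Type u) [Ring R] (S : Subring R)
    (hfrob : IsFrobeniusExtension S)
    (hsplit : Module.Free ↥S R ∨ IsLeftSplitExtension S ∨ (∀ a b : ↥S, a * b = b * a)) :
    (∀ n : ℕ, fddGE R n R ↔ fddGE ↥S n ↥S) ∧
    (∀ n : ℕ, domdimGE R n R ↔ domdimGE ↥S n ↥S) := by
  obtain ⟨m, ⟨Z⟩⟩ := hfrob.exists_frobeniusSystem
  obtain ⟨i, p, hpi⟩ := hfrob.exists_retract hsplit
  refine ⟨fun n ↦ ?_, fun n ↦ ?_⟩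
  · rw [fddGE_iff_hasCoresolution, fddGE_iff_hasCoresolution]
    exact Z.hasCoresolution_iff (fun I _ _ ↦ Z.equationallyFlat_restrict)
      (fun I _ _ ↦ Z.equationallyFlat_coinduced) (fun I J _ _ _ _ ↦ .prod) i p hpi n
  · rw [domdimGE_iff_hasCoresolution, domdimGE_iff_hasCoresolution]
    exact Z.hasCoresolution_iff (fun I _ _ ↦ Z.projective_restrict)
      (fun I _ _ ↦ Z.projective_coinduced) (fun I J _ _ _ _ _ _ ↦ inferInstance) i p hpi n
end

section
/- Let A and B be finite-dimensional algebras over a field k and M a Frobenius B-A-bimodule. For every finitely generated left A-module X there is an isomorphism of left B-modules ν_B(M ⊗_A X) ≅ M ⊗_A ν_A X, and for every finitely generated left B-module Y there is an isomorphism of left A-modules ν_A Hom_B(M, Y) ≅ Hom_B(M, ν_B Y). -/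
/-!
Statement 5: Let `A`, `B` be finite-dimensional algebras over a field `k` and `M` a
Frobenius `B`-`A`-bimodule.  Then `ν_B (M ⊗_A X) ≅ M ⊗_A ν_A X` as left `B`-modules for
every finitely generated `A`-module `X`, and `ν_A Hom_B(M, Y) ≅ Hom_B(M, ν_B Y)` as left
`A`-modules for every finitely generated `B`-module `Y`, where `ν = D Hom(-, regular)` is
the Nakayama functor.
-/

universe u
open MulOpposite
section FrobeniusBimodule

variable (S R M : Type u) [Ring S] [Ring R] [AddCommGroup M]
  [Module S M] [Module Rᵐᵒᵖ M] [SMulCommClass S Rᵐᵒᵖ M] [SMulCommClass Rᵐᵒᵖ S M]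

/-- The right action of `r : R` on the `S`-`R`-bimodule `M`, as an `S`-linear map. -/
def ract (r : R) : M →ₗ[S] M where
  toFun m := op r • m
  map_add' _ _ := smul_add _ _ _
  map_smul' s m := smul_comm (op r) s m

/-- The left action of `s : S` on the `S`-`R`-bimodule `M`, as a right `R`-linear map. -/
def lact (s : S) : M →ₗ[Rᵐᵒᵖ] M where
  toFun m := s • m
  map_add' _ _ := smul_add _ _ _
  map_smul' r m := smul_comm s r m

/-- Left multiplication by `r : R` on `R`, as a right `R`-linear map. -/
def mulLeft' (r : R) : R →ₗ[Rᵐᵒᵖ] R where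
  toFun x := r * x
  map_add' := mul_add r
  map_smul' a x := by
    simp only [MulOpposite.smul_eq_mul_unop, RingHom.id_apply, mul_assoc]

/-- An `S`-`R`-bimodule `M` is a Frobenius bimodule if it is finitely generated projective
as a left `S`-module and as a right `R`-module, and `Hom_S(M, S) ≅ Hom_{Rᵒᵖ}(M, R)` as
`R`-`S`-bimodules.  Here `Hom_S(M, S)` is an `R`-`S`-bimodule via `(r • f • s) m = f (m r) s`,
and `Hom_{Rᵒᵖ}(M, R)` is an `R`-`S`-bimodule via `(r • g • s) m = r * g (s • m)`; the
bimodule conditions on the additive isomorphism `e` are stated via the two compatibilities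
below. -/
def IsFrobeniusBimodule : Prop :=
  Module.Finite S M ∧ Module.Projective S M ∧
  Module.Finite Rᵐᵒᵖ M ∧ Module.Projective Rᵐᵒᵖ M ∧
  ∃ e : (M →ₗ[S] S) ≃+ (M →ₗ[Rᵐᵒᵖ] R),
    (∀ (r : R) (f : M →ₗ[S] S), e (f ∘ₗ ract S R M r) = mulLeft' R r ∘ₗ e f) ∧
    (∀ (s : S) (f : M →ₗ[S] S),
      e (LinearMap.toSpanSingleton S S s ∘ₗ f) = e f ∘ₗ lact S R M s)

variable (Y : Type u) [AddCommGroup Y] [Module S Y]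

/-- `Hom_S(M, Y)` is a left `R`-module via the right action of `R` on `M`:
`(r • f) m = f (m r)`. -/
instance homLeftModule : Module R (M →ₗ[S] Y) where
  smul r f := f ∘ₗ ract S R M r
  one_smul f := by ext m; show f _ = f m; simp [ract]
  mul_smul r r' f := by ext m; show f _ = f _; simp [ract, op_mul, mul_smul]
  smul_zero r := rfl
  smul_add r f g := rfl
  add_smul r r' f := by ext m; show f _ = f _ + f _; simp [ract, op_add, add_smul, map_add]
  zero_smul f := by ext m; show f _ = 0; simp [ract]

/-- The left `R`-action on `Hom_S(M, Y)` through the domain commutes with any compatible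
action on the codomain. -/
instance homActionsComm (T : Type u) [Ring T] [Module T Y] [SMulCommClass S T Y] :
    SMulCommClass T R (M →ₗ[S] Y) :=
  ⟨fun _ _ _ => rfl⟩

end FrobeniusBimodule
section NCTensor

variable (R : Type u) [Ring R] (M : Type u) [AddCommGroup M] [Module Rᵐᵒᵖ M]
  (X : Type u) [AddCommGroup X] [Module R X]
  (S : Type u) [Ring S] [Module S M] [SMulCommClass Rᵐᵒᵖ S M]

/-- The submodule of balanced relations in `M ⊗[ℤ] X`, where `M` is an `S`-`R`-bimodule
and `X` a left `R`-module.  Since the generating set is stable under the action of `S`,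
its `S`-span coincides with its additive span. -/
def balS : Submodule S (TensorProduct ℤ M X) :=
  Submodule.span S
    {z | ∃ (m : M) (r : R) (x : X), z = m ⊗ₜ[ℤ] (r • x) - ((op r) • m) ⊗ₜ[ℤ] x}

/-- The tensor product `M ⊗_R X` over the (possibly noncommutative) ring `R`, for a right
`R`-module `M` and a left `R`-module `X`: the quotient of `M ⊗[ℤ] X` by the balanced
relations.  When `M` is an `S`-`R`-bimodule this is a left `S`-module. -/
def NCT := (TensorProduct ℤ M X) ⧸ balS R M X S

noncomputable instance : AddCommGroup (NCT R M X S) :=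
  inferInstanceAs (AddCommGroup ((TensorProduct ℤ M X) ⧸ balS R M X S))

noncomputable instance : Module S (NCT R M X S) :=
  inferInstanceAs (Module S ((TensorProduct ℤ M X) ⧸ balS R M X S))

/-- The class of the pure tensor `m ⊗ x` in `M ⊗_R X`. -/
noncomputable def mkT (m : M) (x : X) : NCT R M X S :=
  Submodule.Quotient.mk (m ⊗ₜ[ℤ] x)

end NCTensor

section DualComparison

theorem homLeftModule_smul_apply {S R M Y : Type u} [Ring S] [Ring R] [AddCommGroup M]
    [Module S M] [Module Rᵐᵒᵖ M] [SMulCommClass Rᵐᵒᵖ S M]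
    [AddCommGroup Y] [Module S Y] (r : R) (f : M →ₗ[S] Y) (m : M) :
    (r • f) m = f (op r • m) := rfl

/-- Nonzero elements killed by pairwise distinct maximal ideals are linearly independent. -/
theorem linearIndependent_of_annihilated_by_maximal {K R E ι : Type*} [Field K] [CommRing R]
    [AddCommGroup E] [Module R E] [Module K E] [SMulCommClass R K E]
    (m : ι → Ideal R) (hm : ∀ i, (m i).IsMaximal) (hinj : Function.Injective m)
    (e : ι → E) (he : ∀ i, e i ≠ 0) (hann : ∀ i, ∀ r ∈ m i, r • e i = 0) :
    LinearIndependent K e := by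
  classical
  rw [linearIndependent_iff']
  intro s g hg i hi
  by_contra hgi
  have hprime := (hm i).isPrime
  obtain ⟨r, hr, hri⟩ : ∃ r ∈ (s.erase i).inf m, r ∉ m i := by
    by_contra! h
    obtain ⟨j, hj, hji⟩ := (hprime.inf_le' (s := s.erase i) (f := m)).1 h
    exact (Finset.mem_erase.1 hj).1 (hinj ((hm j).eq_of_le hprime.ne_top hji))
  have hr0 : r • e i = 0 := by
    have h := congrArg (r • ·) hg
    simp only [Finset.smul_sum, smul_zero] at h
    rw [Finset.sum_eq_single_of_mem i hi, smul_comm] at h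
    · exact (smul_eq_zero.1 h).resolve_left hgi
    · intro j hj hji
      rw [smul_comm, hann j r ((Finset.inf_le (Finset.mem_erase.2 ⟨hji, hj⟩) : _ ≤ m j) hr),
        smul_zero]
  obtain ⟨y, z, hz, hyz⟩ := (hm i).exists_inv hri
  apply he i
  rw [← one_smul R (e i), ← hyz, add_smul, mul_smul, hr0, smul_zero, zero_add, hann i z hz]

/-- If all socle components of an Artinian `R`-module are simple or zero, then there is
a linear functional whose kernel contains no nonzero `R`-submodule. -/
theorem exists_functional_nondegenerate {K R E : Type*} [Field K] [CommRing R]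
    [IsArtinianRing R] [AddCommGroup E] [Module R E] [Module K E] [SMulCommClass R K E]
    (hE : ∀ m : Ideal R, m.IsMaximal → ∀ ψ e : E, (∀ r ∈ m, r • ψ = 0) →
      (∀ r ∈ m, r • e = 0) → ψ ≠ 0 → ∃ r : R, r • ψ = e) :
    ∃ l : E →ₗ[K] K, ∀ φ : E, φ ≠ 0 → ∃ r : R, l (r • φ) ≠ 0 := by
  let ι := {m : Ideal R // m.IsMaximal ∧ ∃ e : E, e ≠ 0 ∧ ∀ r ∈ m, r • e = 0}
  choose e he hann using fun i : ι => i.2.2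
  have hli : LinearIndependent K e :=
    linearIndependent_of_annihilated_by_maximal (fun i : ι => i.1) (fun i => i.2.1)
      Subtype.val_injective e he hann
  obtain ⟨l, hl⟩ : ∃ l : E →ₗ[K] K, ∀ i, l (e i) = 1 := by
    obtain ⟨l, hl⟩ := LinearMap.exists_extend
      ((Finsupp.linearCombination K fun _ : ι => (1 : K)) ∘ₗ hli.repr)
    refine ⟨l, fun i => ?_⟩
    have h := LinearMap.congr_fun hl ⟨e i, Submodule.subset_span ⟨i, rfl⟩⟩
    simpa [hli.repr_eq_single i] using h
  refine ⟨l, fun φ hφ => ?_⟩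
  obtain ⟨p, hp, -⟩ := exists_le_isAssociatedPrime_of_isNoetherianRing R
    (⟨φ, Submodule.mem_span_singleton_self φ⟩ : Submodule.span R {φ})
    (by simpa [Subtype.ext_iff] using hφ)
  obtain ⟨hprime, ⟨ψ, hψ⟩, hpψ⟩ := isAssociatedPrime_iff.1 hp
  have hmax : p.IsMaximal := inferInstance
  obtain ⟨r, rfl⟩ := Submodule.mem_span_singleton.1 hψ
  have hmem : ∀ t, t ∈ p ↔ t • r • φ = 0 := fun t => by
    rw [hpψ, Submodule.mem_colon_singleton, Submodule.mem_bot, Subtype.ext_iff]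
    rfl
  have h0 : r • φ ≠ 0 := fun h =>
    hprime.ne_top ((Ideal.eq_top_iff_one p).2 ((hmem 1).2 (by rw [h, smul_zero])))
  have hkill : ∀ t ∈ p, t • r • φ = 0 := fun t => (hmem t).1
  let i : ι := ⟨p, hmax, r • φ, h0, hkill⟩
  obtain ⟨t, ht⟩ := hE p hmax (r • φ) (e i) hkill (hann i) h0
  refine ⟨t * r, ?_⟩
  rw [mul_smul, ht, hl]
  exact one_ne_zero

/-- The socle components of the dual of a finite-dimensional commutative algebra are simple. -/
theorem dual_socle_simple {F R : Type u} [Field F] [CommRing R] [Algebra F R]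
    [FiniteDimensional F R] (m : Ideal R) (hm : m.IsMaximal) (ψ e : R →ₗ[F] F)
    (hψ : ∀ r ∈ m, r • ψ = 0) (he : ∀ r ∈ m, r • e = 0) (h0 : ψ ≠ 0) :
    ∃ r : R, r • ψ = e := by
  by_contra! hne
  let W : Submodule F (Module.Dual F R) :=
    { carrier := Set.range fun r : R => r • ψ
      add_mem' := by
        rintro _ _ ⟨r, rfl⟩ ⟨s, rfl⟩
        exact ⟨r + s, add_smul r s ψ⟩
      zero_mem' := ⟨0, zero_smul R ψ⟩
      smul_mem' := by
        rintro c _ ⟨r, rfl⟩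
        refine ⟨c • r, LinearMap.ext fun x => ?_⟩
        change ψ (x * c • r) = c • ψ (x * r)
        rw [mul_smul_comm, map_smul] }
  have heW : e ∉ W := fun ⟨r, hr⟩ => hne r hr
  rw [← Subspace.dualCoannihilator_dualAnnihilator_eq (W := W),
    Submodule.mem_dualAnnihilator] at heW
  push Not at heW
  obtain ⟨x, hx, hex⟩ := heW
  have hxm : x ∉ m := fun hxm => hex <| by
    have h := LinearMap.congr_fun (he x hxm) 1
    change e (1 * x) = 0 at h
    rwa [one_mul] at h
  obtain ⟨y, z, hz, hyz⟩ := hm.exists_inv hxm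
  apply h0
  ext t
  have h1 : ψ (x * (y * t)) = 0 :=
    (Submodule.mem_dualCoannihilator _).1 hx _ ⟨y * t, rfl⟩
  have h2 : ψ (t * z) = 0 := LinearMap.congr_fun (hψ z hz) t
  have h3 : t = x * (y * t) + t * z := by
    linear_combination (-t) * hyz
  rw [h3, map_add, h1, h2, add_zero, LinearMap.zero_apply]

/-- The dual of a commutative algebra finite-dimensional over two fields embeds from one
dual into the other. -/
theorem exists_injective_dual_to_dual (F K R : Type u) [Field F] [Field K] [CommRing R]
    [Algebra F R] [Algebra K R] [FiniteDimensional F R] :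
    ∃ f : (R →ₗ[F] F) →ₗ[R] (R →ₗ[K] K), Function.Injective f := by
  let : Module K (R →ₗ[F] F) := Module.compHom _ (algebraMap K R)
  have hK : ∀ (c : K) (φ : R →ₗ[F] F), c • φ = algebraMap K R c • φ := fun _ _ => rfl
  have : SMulCommClass R K (R →ₗ[F] F) :=
    ⟨fun r c φ => by rw [hK, hK, ← mul_smul, ← mul_smul, mul_comm]⟩
  have : IsArtinianRing R := IsArtinianRing.of_finite F R
  obtain ⟨l, hl⟩ := exists_functional_nondegenerate (K := K) (R := R) (E := R →ₗ[F] F)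
    fun m hm ψ e hψ he h0 => dual_socle_simple m hm ψ e hψ he h0
  refine ⟨{ toFun := fun φ =>
              { toFun := fun r => l (r • φ)
                map_add' := fun r s => by rw [add_smul, map_add]
                map_smul' := fun c r => by
                  rw [Algebra.smul_def, mul_smul, ← hK, map_smul, RingHom.id_apply] }
            map_add' := fun φ φ' => by
              ext r; simp [smul_add]
            map_smul' := fun s φ => by
              ext r
              change l (r • s • φ) = l ((r * s) • φ)
              rw [mul_smul] }, ?_⟩
  rw [injective_iff_map_eq_zero]
  intro φ hφ
  by_contra h0
  obtain ⟨r, hr⟩ := hl φ h0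
  exact hr (LinearMap.congr_fun hφ r)

/-- The two duals of a commutative algebra finite-dimensional over two fields are isomorphic. -/
theorem nonempty_dual_equiv_dual (F K R : Type u) [Field F] [Field K] [CommRing R]
    [Algebra F R] [Algebra K R] [FiniteDimensional F R] [FiniteDimensional K R] :
    Nonempty ((R →ₗ[F] F) ≃ₗ[R] (R →ₗ[K] K)) := by
  obtain ⟨f, hf⟩ := exists_injective_dual_to_dual F K R
  obtain ⟨g, hg⟩ := exists_injective_dual_to_dual K F R
  have : IsScalarTower K R (R →ₗ[K] K) := ⟨fun c r φ => by
    ext x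
    change φ (x * c • r) = c • φ (x * r)
    rw [mul_smul_comm, map_smul]⟩
  have hsurj : Function.Surjective (f ∘ₗ g) :=
    (LinearMap.injective_iff_surjective (f := (f ∘ₗ g).restrictScalars K)).1 (hf.comp hg)
  exact ⟨LinearEquiv.ofBijective f ⟨hf, Function.Surjective.of_comp (g := g) hsurj⟩⟩

section Transfer

variable {F K R : Type u} (T N : Type u) [Field F] [Field K] [CommRing R]
    [Algebra F R] [Algebra K R] [Ring T] [AddCommGroup N] [Module F N] [Module K N]
    [Module R N] [Module Tᵐᵒᵖ N] [IsScalarTower F R N] [IsScalarTower K R N]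
    [SMulCommClass Tᵐᵒᵖ F N]
    [SMulCommClass Tᵐᵒᵖ K N] [SMulCommClass R Tᵐᵒᵖ N]

/-- The functional `r ↦ φ (r • n)` on the scalar ring. -/
def orbitFunctional {N : Type u} [AddCommGroup N] [Module F N] [Module R N]
    [IsScalarTower F R N] (φ : N →ₗ[F] F) (n : N) : R →ₗ[F] F :=
  φ ∘ₗ (LinearMap.toSpanSingleton R N n).restrictScalars F

theorem orbitFunctional_apply {N : Type u} [AddCommGroup N] [Module F N] [Module R N]
    [IsScalarTower F R N] (φ : N →ₗ[F] F) (n : N) (r : R) :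
    orbitFunctional φ n r = φ (r • n) := rfl

theorem orbitFunctional_smul {N : Type u} [AddCommGroup N] [Module F N] [Module R N]
    [IsScalarTower F R N] (φ : N →ₗ[F] F) (n : N) (r : R) :
    orbitFunctional (R := R) φ (r • n) = r • orbitFunctional φ n := by
  ext x
  change φ (x • r • n) = φ ((x * r) • n)
  rw [mul_smul]

/-- An `R`-linear map between the duals of `R` induces a map between the duals of any
`R`-module. -/
def dualTransfer (E : (R →ₗ[F] F) →ₗ[R] (R →ₗ[K] K)) : (N →ₗ[F] F) →ₗ[T] (N →ₗ[K] K) where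
  toFun φ :=
    { toFun := fun n => E (orbitFunctional φ n) 1
      map_add' := fun n n' => by
        have h : orbitFunctional (R := R) φ (n + n') =
            orbitFunctional φ n + orbitFunctional φ n' := by
          ext r
          simp [orbitFunctional_apply]
        rw [h, map_add, LinearMap.add_apply]
      map_smul' := fun c n => by
        rw [← algebraMap_smul R c n, orbitFunctional_smul, map_smul, homLeftModule_smul_apply,
          op_smul_eq_mul, one_mul, Algebra.algebraMap_eq_smul_one, map_smul,
          RingHom.id_apply] }
  map_add' φ φ' := by
    ext n
    have h : orbitFunctional (R := R) (φ + φ') n =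
        orbitFunctional φ n + orbitFunctional φ' n := rfl
    change E _ 1 = E _ 1 + E _ 1
    rw [h, map_add, LinearMap.add_apply]
  map_smul' t φ := by
    ext n
    change E (orbitFunctional (t • φ) n) 1 = E (orbitFunctional φ (op t • n)) 1
    congr 2
    ext r
    change φ (op t • r • n) = φ (r • op t • n)
    rw [smul_comm r (op t) n]

theorem orbitFunctional_dualTransfer (E : (R →ₗ[F] F) →ₗ[R] (R →ₗ[K] K)) (φ : N →ₗ[F] F)
    (n : N) : orbitFunctional (dualTransfer T N E φ) n = E (orbitFunctional φ n) := by
  ext r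
  change E (orbitFunctional φ (r • n)) 1 = _
  rw [orbitFunctional_smul, map_smul, homLeftModule_smul_apply, op_smul_eq_mul,
    one_mul]

/-- An isomorphism between the duals of `R` induces an isomorphism between the duals of any
`R`-module. -/
def dualTransferEquiv (E : (R →ₗ[F] F) ≃ₗ[R] (R →ₗ[K] K)) :
    (N →ₗ[F] F) ≃ₗ[T] (N →ₗ[K] K) :=
  LinearEquiv.ofLinearMap (dualTransfer T N E.toLinearMap) (dualTransfer T N E.symm.toLinearMap)
    (by
      ext φ n
      change E (orbitFunctional (dualTransfer T N E.symm.toLinearMap φ) n) 1 = φ n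
      rw [orbitFunctional_dualTransfer]
      simp [orbitFunctional_apply])
    (by
      ext φ n
      change E.symm (orbitFunctional (dualTransfer T N E.toLinearMap φ) n) 1 = φ n
      rw [orbitFunctional_dualTransfer]
      simp [orbitFunctional_apply])

end Transfer

/-- A module that is finite-dimensional over two commuting fields has isomorphic duals over
these fields. -/
theorem nonempty_dual_equiv (F K T N : Type u) [Field F] [Field K]
    [Ring T] [AddCommGroup N] [Module F N] [Module K N] [Module Tᵐᵒᵖ N]
    [SMulCommClass F K N] [SMulCommClass Tᵐᵒᵖ F N]
    [SMulCommClass Tᵐᵒᵖ K N]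
    [FiniteDimensional F N] [FiniteDimensional K N] :
    Nonempty ((N →ₗ[F] F) ≃ₗ[T] (N →ₗ[K] K)) := by
  let s : Set (Module.End ℤ N) :=
    Set.range (Module.toModuleEnd ℤ (S := F) N) ∪ Set.range (Module.toModuleEnd ℤ (S := K) N)
  have hs : ∀ f ∈ s, ∀ g ∈ s, f * g = g * f := by
    rintro _ (⟨c, rfl⟩ | ⟨c, rfl⟩) _ (⟨d, rfl⟩ | ⟨d, rfl⟩) <;> ext n
    · exact smul_comm c d n
    · exact smul_comm c d n
    · exact (smul_comm d c n).symm
    · exact smul_comm c d n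
  let R := Subring.closure s
  let _ : CommRing R :=
    { (inferInstance : Ring R) with
      mul_comm := (Subring.isMulCommutative_closure hs).is_comm.comm }
  have hcomm : ∀ f : Module.End ℤ N, (∀ g ∈ s, g * f = f * g) → ∀ r : R, f * r.1 = r.1 * f :=
    fun f hf r =>
      Set.mem_centralizer_iff.1 (Subring.closure_le_centralizer_centralizer s r.2) f
        (Set.mem_centralizer_iff.2 hf)
  let _ : Algebra F R := ((Module.toModuleEnd ℤ (S := F) N).codRestrict R
    fun c => Subring.subset_closure (Or.inl ⟨c, rfl⟩)).toAlgebra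
  let _ : Algebra K R := ((Module.toModuleEnd ℤ (S := K) N).codRestrict R
    fun c => Subring.subset_closure (Or.inr ⟨c, rfl⟩)).toAlgebra
  have hF (c : F) (r : R) (n : N) : (c • r).1 n = c • r.1 n := rfl
  have hK (c : K) (r : R) (n : N) : (c • r).1 n = c • r.1 n := rfl
  have hF' (c : F) (r : R) (n : N) : r.1 (c • n) = c • r.1 n :=
    LinearMap.congr_fun (hcomm _ (fun g hg => hs g hg _ (Or.inl ⟨c, rfl⟩)) r).symm n
  have hK' (c : K) (r : R) (n : N) : r.1 (c • n) = c • r.1 n :=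
    LinearMap.congr_fun (hcomm _ (fun g hg => hs g hg _ (Or.inr ⟨c, rfl⟩)) r).symm n
  have : FiniteDimensional F R := Module.Finite.of_injective
    ({ toFun := fun r =>
        { toFun := r.1
          map_add' := map_add r.1
          map_smul' := fun c n => hF' c r n }
       map_add' := fun _ _ => rfl
       map_smul' := fun _ _ => rfl } : R →ₗ[F] Module.End F N)
    fun r r' h => Subtype.ext (LinearMap.ext fun n => LinearMap.congr_fun h n)
  have : FiniteDimensional K R := Module.Finite.of_injective
    ({ toFun := fun r =>
        { toFun := r.1
          map_add' := map_add r.1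
          map_smul' := fun c n => hK' c r n }
       map_add' := fun _ _ => rfl
       map_smul' := fun _ _ => rfl } : R →ₗ[K] Module.End K N)
    fun r r' h => Subtype.ext (LinearMap.ext fun n => LinearMap.congr_fun h n)
  let _ : Module R N := Module.compHom N R.subtype
  have : IsScalarTower F R N := ⟨fun _ _ _ => rfl⟩
  have : IsScalarTower K R N := ⟨fun _ _ _ => rfl⟩
  have : SMulCommClass R Tᵐᵒᵖ N := ⟨fun r t n => by
    refine LinearMap.congr_fun (hcomm (Module.toModuleEnd ℤ (S := Tᵐᵒᵖ) N t) ?_ r).symm n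
    rintro _ (⟨c, rfl⟩ | ⟨c, rfl⟩) <;> ext n <;> exact (smul_comm t c n).symm⟩
  obtain ⟨E⟩ := nonempty_dual_equiv_dual F K R
  exact ⟨dualTransferEquiv T N E⟩

end DualComparison

section Auxiliary

theorem finiteDimensional_linearMap (F S N P : Type*) [Field F] [Ring S] [AddCommGroup N]
    [Module S N] [Module.Finite S N] [AddCommGroup P] [Module S P] [Module F P]
    [SMulCommClass S F P] [FiniteDimensional F P] : FiniteDimensional F (N →ₗ[S] P) := by
  obtain ⟨n, s, hs⟩ := Module.Finite.exists_fin (R := S) (M := N)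
  exact Module.Finite.of_injective
    ({ toFun := fun f i => f (s i)
       map_add' := fun _ _ => rfl
       map_smul' := fun _ _ => rfl } : (N →ₗ[S] P) →ₗ[F] (Fin n → P))
    fun f g h => LinearMap.ext_on_range hs fun i => congrFun h i

theorem exists_dual_basis (R M : Type*) [Ring R] [AddCommGroup M] [Module R M]
    [Module.Finite R M] [Module.Projective R M] :
    ∃ (n : ℕ) (m : Fin n → M) (φ : Fin n → M →ₗ[R] R), ∀ x, ∑ i, φ i x • m i = x := by
  obtain ⟨n, f, g, -, -, h⟩ := Module.Finite.exists_comp_eq_id_of_projective R M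
  refine ⟨n, fun i => f (Pi.single i 1), fun i => LinearMap.proj i ∘ₗ g, fun x => ?_⟩
  have hx : f (g x) = x := LinearMap.congr_fun h x
  conv_rhs => rw [← hx, pi_eq_sum_univ' (g x), map_sum]
  refine Finset.sum_congr rfl fun i _ => ?_
  change g x i • f (Pi.single i 1) = _
  rw [← map_smul]

theorem exists_right_dual_basis (R M : Type*) [Ring R] [AddCommGroup M] [Module Rᵐᵒᵖ M]
    [Module.Finite Rᵐᵒᵖ M] [Module.Projective Rᵐᵒᵖ M] :
    ∃ (n : ℕ) (m : Fin n → M) (φ : Fin n → M →ₗ[Rᵐᵒᵖ] R),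
      ∀ x, ∑ i, op (φ i x) • m i = x := by
  obtain ⟨n, m, φ, h⟩ := exists_dual_basis Rᵐᵒᵖ M
  exact ⟨n, m, fun i =>
    { toFun := fun x => unop (φ i x)
      map_add' := fun x y => by rw [map_add, unop_add]
      map_smul' := fun a x => by
        rw [map_smul, smul_eq_mul, unop_mul, RingHom.id_apply, MulOpposite.smul_eq_mul_unop] },
    h⟩

/-- A linear isomorphism compatible with right `T`-actions dualizes to a `T`-linear one. -/
def dualCongr {F T N N' : Type u} [Field F] [Ring T] [AddCommGroup N] [AddCommGroup N']
    [Module F N] [Module F N'] [Module Tᵐᵒᵖ N] [Module Tᵐᵒᵖ N']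
    [SMulCommClass Tᵐᵒᵖ F N]
    [SMulCommClass Tᵐᵒᵖ F N']
    (f : N ≃ₗ[F] N') (hf : ∀ (t : T) (n : N), f (op t • n) = op t • f n) :
    (N →ₗ[F] F) ≃ₗ[T] (N' →ₗ[F] F) where
  toFun φ := φ ∘ₗ f.symm.toLinearMap
  invFun φ := φ ∘ₗ f.toLinearMap
  map_add' _ _ := rfl
  map_smul' t φ := by
    ext n
    change φ (op t • f.symm n) = φ (f.symm (op t • n))
    congr 1
    apply f.injective
    rw [hf, f.apply_symm_apply, f.apply_symm_apply]
  left_inv φ := by ext n; simp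
  right_inv φ := by ext n; simp

instance homActionsComm' (S R M Y T : Type u) [Ring S] [Ring R] [AddCommGroup M]
    [Module S M] [Module Rᵐᵒᵖ M] [SMulCommClass Rᵐᵒᵖ S M]
    [AddCommGroup Y] [Module S Y] [Ring T] [Module T Y] [SMulCommClass S T Y] :
    SMulCommClass R T (M →ₗ[S] Y) :=
  ⟨fun _ _ _ => rfl⟩

end Auxiliary

section Tensor

variable {R M X S : Type u} [Ring R] [AddCommGroup M] [Module Rᵐᵒᵖ M]
  [AddCommGroup X] [Module R X] [Ring S] [Module S M]

theorem mkT_add_left (m m' : M) (x : X) :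
    mkT R M X S (m + m') x = mkT R M X S m x + mkT R M X S m' x :=
  (congrArg (Submodule.Quotient.mk (p := balS R M X S)) (TensorProduct.add_tmul m m' x)).trans
    (Submodule.Quotient.mk_add _)

theorem mkT_add_right (m : M) (x x' : X) :
    mkT R M X S m (x + x') = mkT R M X S m x + mkT R M X S m x' :=
  (congrArg (Submodule.Quotient.mk (p := balS R M X S)) (TensorProduct.tmul_add m x x')).trans
    (Submodule.Quotient.mk_add _)

theorem mkT_smul_left (s : S) (m : M) (x : X) :
    mkT R M X S (s • m) x = s • mkT R M X S m x :=
  (congrArg (Submodule.Quotient.mk (p := balS R M X S))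
    (TensorProduct.smul_tmul' s m x).symm).trans (Submodule.Quotient.mk_smul _ s _)

theorem mkT_balanced (m : M) (r : R) (x : X) :
    mkT R M X S m (r • x) = mkT R M X S (op r • m) x :=
  (Submodule.Quotient.eq _).2 (Submodule.subset_span ⟨m, r, x, rfl⟩)

theorem mkT_sum_left {ι : Type*} (s : Finset ι) (m : ι → M) (x : X) :
    mkT R M X S (∑ i ∈ s, m i) x = ∑ i ∈ s, mkT R M X S (m i) x :=
  map_sum (AddMonoidHom.mk' (fun m => mkT R M X S m x) fun m m' => mkT_add_left m m' x) m s

theorem nct_induction {p : NCT R M X S → Prop} (z : NCT R M X S)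
    (h0 : p 0) (hmk : ∀ m x, p (mkT R M X S m x)) (hadd : ∀ z w, p z → p w → p (z + w)) :
    p z := by
  obtain ⟨t, rfl⟩ := Submodule.Quotient.mk_surjective (balS R M X S) z
  induction t with
  | zero => exact h0
  | tmul m x => exact hmk m x
  | add t t' ht ht' => exact hadd _ _ ht ht'

/-- Balanced bi-additive maps that are linear in the first variable factor through `NCT`. -/
noncomputable def nctLift {P : Type u} [AddCommGroup P] [Module S P]
    (f : M →ₗ[S] X →ₗ[ℤ] P) (hf : ∀ m (r : R) x, f m (r • x) = f (op r • m) x) :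
    NCT R M X S →ₗ[S] P :=
  (balS R M X S).liftQ (TensorProduct.AlgebraTensorModule.lift f) <|
    Submodule.span_le.2 <| by
      rintro _ ⟨m, r, x, rfl⟩
      simp [hf]

end Tensor

section FrobeniusPairing

/-- A perfect pairing `L × M → A`, linear over `A` and balanced over `B`, together with a pair
of dual bases. -/
structure FrobeniusPairing (A B M L : Type u) [Ring A] [Ring B] [AddCommGroup M] [Module B M]
    [Module Aᵐᵒᵖ M] [AddCommGroup L] [Module A L] [Module Bᵐᵒᵖ L] where
  /-- the pairing -/
  pair : L →+ M →+ A
  pair_smul_left : ∀ (a : A) f m, pair (a • f) m = a * pair f m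
  pair_op_smul : ∀ (b : B) f m, pair (op b • f) m = pair f (b • m)
  pair_smul_right : ∀ (a : A) f m, pair f (op a • m) = pair f m * a
  /-- the size of the dual bases -/
  size : ℕ
  /-- the basis elements of the module -/
  elt : Fin size → M
  /-- the basis elements of the dual module -/
  func : Fin size → L
  sum_elt : ∀ m, ∑ i, op (pair (func i) m) • elt i = m
  sum_func : ∀ f, ∑ i, pair f (elt i) • func i = f

theorem IsFrobeniusBimodule.nonempty_pairing {A B M : Type u} [Ring A] [Ring B]
    [AddCommGroup M] [Module B M] [Module Aᵐᵒᵖ M] [SMulCommClass B Aᵐᵒᵖ M]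
    [SMulCommClass Aᵐᵒᵖ B M] (hM : IsFrobeniusBimodule B A M) :
    Nonempty (FrobeniusPairing A B M (M →ₗ[B] B)) := by
  obtain ⟨-, -, hfin, hproj, e, heA, heB⟩ := hM
  obtain ⟨n, m, φ, h⟩ := exists_right_dual_basis A M
  have hA (a : A) (f : M →ₗ[B] B) (x : M) : e (a • f) x = a * e f x :=
    LinearMap.congr_fun (heA a f) x
  have hB (b : B) (f : M →ₗ[B] B) (x : M) : e (op b • f) x = e f (b • x) :=
    LinearMap.congr_fun (heB b f) x
  refine ⟨{
    pair := AddMonoidHom.mk' (fun f => (e f).toAddMonoidHom) fun f g => by ext x; simp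
    pair_smul_left := hA
    pair_op_smul := hB
    pair_smul_right := fun a f x => (e f).map_smul (op a) x
    size := n
    elt := m
    func := fun i => e.symm (φ i)
    sum_elt := fun x => by simpa using h x
    sum_func := fun f => ?_ }⟩
  apply e.injective
  ext x
  conv_rhs => rw [← h x]
  simp [hA]

namespace FrobeniusPairing

section TensorDual

variable {K A B M L : Type u} [Field K] [Ring A] [Ring B] [Algebra K A]
  [AddCommGroup M] [Module B M] [Module Aᵐᵒᵖ M]
  [AddCommGroup L] [Module A L] [Module Bᵐᵒᵖ L] (P : FrobeniusPairing A B M L)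

theorem ext_elt {m m' : M} (h : ∀ f, P.pair f m = P.pair f m') : m = m' := by
  rw [← P.sum_elt m, ← P.sum_elt m']
  simp only [h]

/-- The pairing in the first variable, as an `A`-linear map. -/
def pairLeft (m : M) : L →ₗ[A] A where
  toFun f := P.pair f m
  map_add' f g := by rw [map_add, AddMonoidHom.add_apply]
  map_smul' a f := P.pair_smul_left a f m

variable [SMulCommClass A Bᵐᵒᵖ L] [Module K L] [IsScalarTower K A L]
  [SMulCommClass A K L] [SMulCommClass Bᵐᵒᵖ K L]

variable (X : Type u) [AddCommGroup X] [Module A X]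

/-- The natural map `M ⊗_A D Hom_A(X, A) → D Hom_A(X, L)`. -/
noncomputable def tensorDualMap :
    NCT A M ((X →ₗ[A] A) →ₗ[K] K) B →ₗ[B] ((X →ₗ[A] L) →ₗ[K] K) :=
  nctLift
    { toFun := fun m =>
        AddMonoidHom.toIntLinearMap <| AddMonoidHom.mk' (fun ξ : (X →ₗ[A] A) →ₗ[K] K =>
          ({ toFun := fun g => ξ (P.pairLeft m ∘ₗ g)
             map_add' := fun g g' => by rw [LinearMap.comp_add, map_add]
             map_smul' := fun c g => by
              have h : P.pairLeft m ∘ₗ (c • g) = c • P.pairLeft m ∘ₗ g := by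
                ext x
                change P.pairLeft m (c • g x) = c • P.pairLeft m (g x)
                rw [← algebraMap_smul A c (g x), map_smul, algebraMap_smul]
              rw [h, map_smul, RingHom.id_apply] } :
            (X →ₗ[A] L) →ₗ[K] K)) fun _ _ => rfl
      map_add' := fun m m' => by
        ext ξ g
        change ξ _ = ξ _ + ξ _
        rw [← map_add]
        congr 1
        ext x
        exact map_add (P.pair (g x)) m m'
      map_smul' := fun b m => by
        ext ξ g
        change ξ (P.pairLeft (b • m) ∘ₗ g) = ξ (P.pairLeft m ∘ₗ (op b • g))
        congr 1
        ext x
        exact (P.pair_op_smul b (g x) m).symm }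
    fun m a ξ => by
      ext g
      change ξ (op a • (P.pairLeft m ∘ₗ g)) = ξ (P.pairLeft (op a • m) ∘ₗ g)
      congr 1
      ext x
      exact (P.pair_smul_right a (g x) m).symm

theorem tensorDualMap_mkT (m : M) (ξ : (X →ₗ[A] A) →ₗ[K] K) (g : X →ₗ[A] L) :
    P.tensorDualMap X (mkT A M _ B m ξ) g = ξ (P.pairLeft m ∘ₗ g) := rfl

/-- Composition with `a ↦ a • f`, as a `K`-linear map. -/
def compSpan (f : L) : (X →ₗ[A] A) →ₗ[K] (X →ₗ[A] L) where
  toFun h := LinearMap.toSpanSingleton A _ f ∘ₗ h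
  map_add' h h' := LinearMap.comp_add _ _ _
  map_smul' c h := by
    ext1 x
    exact smul_assoc c (h x) f

/-- The natural isomorphism `M ⊗_A D Hom_A(X, A) ≅ D Hom_A(X, L)`. -/
noncomputable def tensorDualEquiv :
    NCT A M ((X →ₗ[A] A) →ₗ[K] K) B ≃ₗ[B] ((X →ₗ[A] L) →ₗ[K] K) where
  __ := P.tensorDualMap X
  invFun ψ := ∑ i, mkT A M _ B (P.elt i) (ψ ∘ₗ compSpan X (P.func i))
  left_inv z := by
    change ∑ i, mkT A M _ B (P.elt i) (P.tensorDualMap X z ∘ₗ compSpan X (P.func i)) = z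
    induction z using nct_induction with
    | h0 =>
      simp only [map_zero, LinearMap.zero_comp]
      refine Finset.sum_eq_zero fun i _ => ?_
      have h := mkT_add_right (R := A) (S := B) (P.elt i) 0 (0 : (X →ₗ[A] A) →ₗ[K] K)
      rwa [add_zero, left_eq_add] at h
    | hmk m ξ =>
      conv_rhs => rw [← P.sum_elt m, mkT_sum_left]
      refine Finset.sum_congr rfl fun i _ => ?_
      rw [← mkT_balanced]
      congr 1
      ext h
      change ξ _ = ξ _
      congr 1
      ext x
      exact P.pair_smul_left (h x) (P.func i) m
    | hadd z w hz hw =>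
      simp only [map_add, LinearMap.add_comp, mkT_add_right, Finset.sum_add_distrib, hz, hw]
  right_inv ψ := by
    change P.tensorDualMap X (∑ i, mkT A M _ B (P.elt i) (ψ ∘ₗ compSpan X (P.func i))) = ψ
    ext g
    rw [map_sum, LinearMap.sum_apply]
    simp only [tensorDualMap_mkT, LinearMap.comp_apply]
    rw [← map_sum]
    congr 1
    ext1 x
    rw [LinearMap.sum_apply]
    exact P.sum_func (g x)

end TensorDual

section HomRepr

variable {K A B M : Type u} [Field K] [Ring A] [Ring B] [Algebra K A]
  [AddCommGroup M] [Module B M] [Module Aᵐᵒᵖ M]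
  [SMulCommClass Aᵐᵒᵖ B M] (P : FrobeniusPairing A B M (M →ₗ[B] B))
  {Y : Type u} [AddCommGroup Y] [Module B Y]

theorem span_comp_smul (a : A) (χ : M →ₗ[B] B) (y : Y) :
    LinearMap.toSpanSingleton B Y y ∘ₗ (a • χ) = a • (LinearMap.toSpanSingleton B Y y ∘ₗ χ) :=
  rfl

theorem span_smul_comp (b : B) (χ : M →ₗ[B] B) (y : Y) :
    LinearMap.toSpanSingleton B Y (b • y) ∘ₗ χ =
      LinearMap.toSpanSingleton B Y y ∘ₗ (op b • χ) := by
  ext m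
  simp [mul_smul]

theorem span_add_comp (χ : M →ₗ[B] B) (y y' : Y) :
    LinearMap.toSpanSingleton B Y (y + y') ∘ₗ χ =
      LinearMap.toSpanSingleton B Y y ∘ₗ χ + LinearMap.toSpanSingleton B Y y' ∘ₗ χ := by
  ext m
  simp

/-- The element of `M` representing an `A`-linear functional along `y`. -/
def reprAt (G : (M →ₗ[B] Y) →ₗ[A] A) (y : Y) : M :=
  ∑ i, op (G (LinearMap.toSpanSingleton B Y y ∘ₗ P.func i)) • P.elt i

theorem pair_reprAt (G : (M →ₗ[B] Y) →ₗ[A] A) (y : Y) (χ : M →ₗ[B] B) :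
    P.pair χ (P.reprAt G y) = G (LinearMap.toSpanSingleton B Y y ∘ₗ χ) := by
  have h : LinearMap.toSpanSingleton B Y y ∘ₗ χ =
      ∑ i, P.pair χ (P.elt i) • (LinearMap.toSpanSingleton B Y y ∘ₗ P.func i) := by
    conv_lhs => rw [← P.sum_func χ]
    ext m
    simp [homLeftModule_smul_apply]
  rw [h, reprAt, map_sum, map_sum]
  refine Finset.sum_congr rfl fun i _ => ?_
  rw [P.pair_smul_right, map_smul, smul_eq_mul]

/-- The element of `Hom_B(Y, M)` representing an `A`-linear functional on `Hom_B(M, Y)`. -/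
def homRepr (G : (M →ₗ[B] Y) →ₗ[A] A) : Y →ₗ[B] M where
  toFun := P.reprAt G
  map_add' y y' := P.ext_elt fun χ => by
    rw [map_add, pair_reprAt, pair_reprAt, pair_reprAt, span_add_comp, map_add]
  map_smul' b y := P.ext_elt fun χ => by
    rw [RingHom.id_apply, ← P.pair_op_smul, pair_reprAt, pair_reprAt, span_smul_comp]

theorem pair_homRepr (G : (M →ₗ[B] Y) →ₗ[A] A) (y : Y) (χ : M →ₗ[B] B) :
    P.pair χ (P.homRepr G y) = G (LinearMap.toSpanSingleton B Y y ∘ₗ χ) :=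
  P.pair_reprAt G y χ

section DualBasis

variable {n : ℕ} (s : Fin n → M) (χ : Fin n → M →ₗ[B] B)

/-- The additive functional on `Hom_B(M, Y)` represented by an element of `Hom_B(Y, M)`. -/
def homEval (u : Y →ₗ[B] M) : (M →ₗ[B] Y) →+ A where
  toFun f := ∑ j, P.pair (χ j) (u (f (s j)))
  map_zero' := by simp
  map_add' f g := by simp [Finset.sum_add_distrib]

theorem homEval_apply (u : Y →ₗ[B] M) (f : M →ₗ[B] Y) :
    P.homEval s χ u f = ∑ j, P.pair (χ j) (u (f (s j))) := rfl

variable {s χ} (hs : ∀ x, ∑ j, χ j x • s j = x)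

include hs

theorem sum_span_comp (f : M →ₗ[B] Y) :
    ∑ j, LinearMap.toSpanSingleton B Y (f (s j)) ∘ₗ χ j = f := by
  ext m
  conv_rhs => rw [← hs m]
  simp

theorem sum_op_smul (φ : M →ₗ[B] B) : ∑ j, op (φ (s j)) • χ j = φ := by
  ext m
  conv_rhs => rw [← hs m]
  simp

theorem homEval_span (u : Y →ₗ[B] M) (φ : M →ₗ[B] B) (y : Y) :
    P.homEval s χ u (LinearMap.toSpanSingleton B Y y ∘ₗ φ) = P.pair φ (u y) := by
  conv_rhs => rw [← sum_op_smul hs φ, map_sum, AddMonoidHom.finsetSum_apply]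
  rw [homEval_apply]
  refine Finset.sum_congr rfl fun j _ => ?_
  rw [P.pair_op_smul, ← map_smul]
  rfl

theorem homEval_smul (u : Y →ₗ[B] M) (a : A) (f : M →ₗ[B] Y) :
    P.homEval s χ u (a • f) = a * P.homEval s χ u f := by
  conv_lhs => rw [← sum_span_comp hs f]
  rw [Finset.smul_sum, map_sum, homEval_apply, Finset.mul_sum]
  refine Finset.sum_congr rfl fun j _ => ?_
  rw [← span_comp_smul, P.homEval_span hs, P.pair_smul_left]

/-- The natural isomorphism `Hom_A(Hom_B(M, Y), A) ≅ Hom_B(Y, M)`. -/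
def homReprEquiv [Module K M] [IsScalarTower K Aᵐᵒᵖ M] [SMulCommClass B K M] :
    ((M →ₗ[B] Y) →ₗ[A] A) ≃ₗ[K] (Y →ₗ[B] M) where
  toFun := P.homRepr
  map_add' G G' := LinearMap.ext fun y => P.ext_elt fun φ => by
    rw [LinearMap.add_apply, map_add, pair_homRepr, pair_homRepr, pair_homRepr,
      LinearMap.add_apply]
  map_smul' c G := LinearMap.ext fun y => by
    change ∑ i, op (c • G _) • P.elt i = c • ∑ i, op (G _) • P.elt i
    simp_rw [Finset.smul_sum, op_smul, smul_assoc]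
  invFun u :=
    { toFun := P.homEval s χ u
      map_add' := map_add _
      map_smul' := P.homEval_smul hs u }
  left_inv G := LinearMap.ext fun f => by
    change ∑ j, P.pair (χ j) (P.homRepr G (f (s j))) = G f
    conv_rhs => rw [← sum_span_comp hs f, map_sum]
    exact Finset.sum_congr rfl fun j _ => P.pair_homRepr G _ _
  right_inv u := LinearMap.ext fun y => P.ext_elt fun φ => by
    rw [pair_homRepr]
    exact P.homEval_span hs u φ y

theorem homReprEquiv_op_smul [SMulCommClass B Aᵐᵒᵖ M] [Module K M] [IsScalarTower K Aᵐᵒᵖ M]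
    [SMulCommClass B K M] (a : A) (G : (M →ₗ[B] Y) →ₗ[A] A) :
    P.homReprEquiv (K := K) hs (op a • G) = op a • P.homReprEquiv (K := K) hs G := by
  ext y
  change ∑ i, op (G _ * a) • P.elt i = op a • ∑ i, op (G _) • P.elt i
  simp_rw [Finset.smul_sum, op_mul, mul_smul]

end DualBasis

end HomRepr

end FrobeniusPairing

end FrobeniusPairing

section Adjunction

variable {F A B M : Type u} [Field F] [Ring A] [Ring B] [Algebra F B]
  [AddCommGroup M] [Module B M] [Module Aᵐᵒᵖ M] [SMulCommClass B Aᵐᵒᵖ M]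
  [SMulCommClass Aᵐᵒᵖ B M]

/-- The natural isomorphism `D Hom_B(Y, M) ≅ Hom_B(M, D Hom_B(Y, B))` for a finitely generated
projective module `M`. -/
def homDualEquiv {Y : Type u} [AddCommGroup Y] [Module B Y] [Module F M] [IsScalarTower F B M]
    [SMulCommClass B F M] [SMulCommClass Aᵐᵒᵖ F M] {n : ℕ} {s : Fin n → M}
    {χ : Fin n → M →ₗ[B] B} (hs : ∀ x, ∑ j, χ j x • s j = x) :
    ((Y →ₗ[B] M) →ₗ[F] F) ≃ₗ[A] (M →ₗ[B] ((Y →ₗ[B] B) →ₗ[F] F)) where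
  toFun ψ :=
    { toFun := fun m =>
        { toFun := fun h => ψ (LinearMap.toSpanSingleton B M m ∘ₗ h)
          map_add' := fun h h' => by rw [LinearMap.comp_add, map_add]
          map_smul' := fun c h => by
            rw [RingHom.id_apply, ← map_smul]
            congr 1
            ext y
            exact smul_assoc c (h y) m }
      map_add' := fun m m' => by
        ext h
        change ψ _ = ψ _ + ψ _
        rw [← map_add]
        congr 1
        ext y
        exact smul_add (h y) m m'
      map_smul' := fun b m => by
        ext h
        change ψ _ = ψ _
        congr 1
        ext y
        exact (mul_smul (h y) b m).symm }
  map_add' _ _ := rfl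
  map_smul' a ψ := by
    ext m h
    change ψ _ = ψ _
    congr 1
    ext y
    exact (smul_comm (h y) (op a) m).symm
  invFun Φ :=
    { toFun := fun u => ∑ j, Φ (s j) (χ j ∘ₗ u)
      map_add' := fun u u' => by
        simp only [LinearMap.comp_add, map_add, Finset.sum_add_distrib]
      map_smul' := fun c u => by
        rw [RingHom.id_apply, Finset.smul_sum]
        refine Finset.sum_congr rfl fun j _ => ?_
        rw [← map_smul]
        congr 1
        ext y
        change χ j (c • u y) = c • χ j (u y)
        rw [← algebraMap_smul B c (u y), map_smul, algebraMap_smul] }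
  left_inv ψ := by
    ext u
    change ∑ j, ψ (LinearMap.toSpanSingleton B M (s j) ∘ₗ χ j ∘ₗ u) = ψ u
    rw [← map_sum]
    congr 1
    ext y
    conv_rhs => rw [← hs (u y)]
    simp
  right_inv Φ := by
    ext m h
    change ∑ j, Φ (s j) (χ j ∘ₗ LinearMap.toSpanSingleton B M m ∘ₗ h) = Φ m h
    conv_rhs => rw [← hs m, map_sum, LinearMap.sum_apply]
    refine Finset.sum_congr rfl fun j _ => ?_
    rw [map_smul, homLeftModule_smul_apply]
    congr 1
    ext y
    simp

/-- The tensor-hom adjunction `Hom_B(M ⊗_A X, B) ≅ Hom_A(X, Hom_B(M, B))`. -/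
noncomputable def nctHomEquiv (X : Type u) [AddCommGroup X] [Module A X] :
    (NCT A M X B →ₗ[B] B) ≃ₗ[F] (X →ₗ[A] (M →ₗ[B] B)) where
  toFun g :=
    { toFun := fun x =>
        { toFun := fun m => g (mkT A M X B m x)
          map_add' := fun m m' => by rw [mkT_add_left, map_add]
          map_smul' := fun b m => by rw [mkT_smul_left, map_smul, RingHom.id_apply] }
      map_add' := fun x x' => by
        ext m
        change g _ = g _ + g _
        rw [mkT_add_right, map_add]
      map_smul' := fun a x => by
        ext m
        exact congrArg g (mkT_balanced m a x) }
  map_add' _ _ := rfl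
  map_smul' _ _ := rfl
  invFun G := nctLift
    { toFun := fun m => AddMonoidHom.toIntLinearMap (AddMonoidHom.mk' (fun x => G x m)
        fun x x' => by rw [map_add, LinearMap.add_apply])
      map_add' := fun m m' => by
        ext x
        exact map_add (G x) m m'
      map_smul' := fun b m => by
        ext x
        exact map_smul (G x) b m }
    fun m a x => by
      change G (a • x) m = G x (op a • m)
      rw [map_smul, homLeftModule_smul_apply]
  left_inv g := by
    ext z
    induction z using nct_induction with
    | h0 => rw [map_zero, map_zero]
    | hmk m x => rfl
    | hadd z w hz hw => rw [map_add, map_add, hz, hw]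
  right_inv G := rfl

end Adjunction

section Nakayama

variable {K F A B M : Type u} [Field K] [Field F] [Ring A] [Ring B] [Algebra K A] [Algebra F B]
  [FiniteDimensional K A] [FiniteDimensional F B]
  [AddCommGroup M] [Module B M] [Module Aᵐᵒᵖ M] [SMulCommClass B Aᵐᵒᵖ M]
  [SMulCommClass Aᵐᵒᵖ B M]

theorem IsFrobeniusBimodule.nonempty_nakayama_tensor (hM : IsFrobeniusBimodule B A M)
    (X : Type u) [AddCommGroup X] [Module A X] [Module.Finite A X] :
    Nonempty (((NCT A M X B →ₗ[B] B) →ₗ[F] F) ≃ₗ[B] NCT A M ((X →ₗ[A] A) →ₗ[K] K) B) := by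
  obtain ⟨P⟩ := hM.nonempty_pairing
  have : Module.Finite B M := hM.1
  let : Module K (M →ₗ[B] B) := Module.compHom _ (algebraMap K A)
  have hK (c : K) (f : M →ₗ[B] B) : c • f = algebraMap K A c • f := rfl
  have : IsScalarTower K A (M →ₗ[B] B) :=
    ⟨fun c a f => by rw [hK, Algebra.smul_def, mul_smul]⟩
  have : SMulCommClass A K (M →ₗ[B] B) :=
    ⟨fun a c f => by rw [hK, hK, ← mul_smul, ← mul_smul, Algebra.commutes]⟩
  have : SMulCommClass Bᵐᵒᵖ K (M →ₗ[B] B) := ⟨fun _ _ _ => rfl⟩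
  have : SMulCommClass F K (M →ₗ[B] B) := ⟨fun _ _ _ => rfl⟩
  have : FiniteDimensional F (M →ₗ[B] B) := finiteDimensional_linearMap F B M B
  have : FiniteDimensional K (M →ₗ[B] B) := Module.Finite.of_injective
    ({ toFun := fun f i => P.pair f (P.elt i)
       map_add' := fun f g => by
        ext i
        rw [map_add]
        rfl
       map_smul' := fun c f => by
        ext i
        change P.pair (algebraMap K A c • f) (P.elt i) = c • P.pair f (P.elt i)
        rw [P.pair_smul_left, Algebra.smul_def] } : (M →ₗ[B] B) →ₗ[K] (Fin P.size → A))
    fun f g h => by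
      rw [← P.sum_func f, ← P.sum_func g]
      exact Finset.sum_congr rfl fun i _ => congrArg (· • P.func i) (congrFun h i)
  have : FiniteDimensional F (X →ₗ[A] (M →ₗ[B] B)) := finiteDimensional_linearMap F A X _
  have : FiniteDimensional K (X →ₗ[A] (M →ₗ[B] B)) := finiteDimensional_linearMap K A X _
  obtain ⟨E⟩ := nonempty_dual_equiv F K B (X →ₗ[A] (M →ₗ[B] B))
  exact ⟨dualCongr (N := NCT A M X B →ₗ[B] B) (N' := X →ₗ[A] (M →ₗ[B] B)) (nctHomEquiv X)
    (fun _ _ => rfl) ≪≫ₗ E ≪≫ₗ (P.tensorDualEquiv X).symm⟩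

theorem IsFrobeniusBimodule.nonempty_nakayama_hom (hM : IsFrobeniusBimodule B A M)
    (Y : Type u) [AddCommGroup Y] [Module B Y] [Module.Finite B Y] :
    Nonempty ((((M →ₗ[B] Y) →ₗ[A] A) →ₗ[K] K) ≃ₗ[A] (M →ₗ[B] ((Y →ₗ[B] B) →ₗ[F] F))) := by
  obtain ⟨P⟩ := hM.nonempty_pairing
  have : Module.Finite B M := hM.1
  have : Module.Projective B M := hM.2.1
  have : Module.Finite Aᵐᵒᵖ M := hM.2.2.1
  obtain ⟨n, s, χ, hs⟩ := exists_dual_basis B M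
  let : Module K M := Module.compHom M (algebraMap K Aᵐᵒᵖ)
  let : Module F M := Module.compHom M (algebraMap F B)
  have hK (c : K) (m : M) : c • m = algebraMap K Aᵐᵒᵖ c • m := rfl
  have hF (c : F) (m : M) : c • m = algebraMap F B c • m := rfl
  have : IsScalarTower K Aᵐᵒᵖ M := ⟨fun c a m => by rw [hK, Algebra.smul_def, mul_smul]⟩
  have : IsScalarTower F B M := ⟨fun c b m => by rw [hF, Algebra.smul_def, mul_smul]⟩
  have : SMulCommClass B K M := ⟨fun b c m => smul_comm b (algebraMap K Aᵐᵒᵖ c) m⟩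
  have : SMulCommClass K B M := .symm B K M
  have : SMulCommClass Aᵐᵒᵖ F M := ⟨fun a c m => smul_comm a (algebraMap F B c) m⟩
  have : SMulCommClass K F M := ⟨fun a c m => smul_comm a (algebraMap F B c) m⟩
  have : SMulCommClass B F M :=
    ⟨fun b c m => by rw [hF, hF, ← mul_smul, ← mul_smul, Algebra.commutes]⟩
  have : SMulCommClass Aᵐᵒᵖ K M :=
    ⟨fun a c m => by rw [hK, hK, ← mul_smul, ← mul_smul, Algebra.commutes]⟩
  have : FiniteDimensional F M := Module.Finite.trans B M
  have : FiniteDimensional K M := Module.Finite.trans Aᵐᵒᵖ M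
  have : FiniteDimensional F (Y →ₗ[B] M) := finiteDimensional_linearMap F B Y M
  have : FiniteDimensional K (Y →ₗ[B] M) := finiteDimensional_linearMap K B Y M
  obtain ⟨E⟩ := nonempty_dual_equiv K F A (Y →ₗ[B] M)
  let E' : (((M →ₗ[B] Y) →ₗ[A] A) →ₗ[K] K) ≃ₗ[A] ((Y →ₗ[B] M) →ₗ[K] K) :=
    dualCongr (P.homReprEquiv hs) (P.homReprEquiv_op_smul hs)
  exact ⟨E' ≪≫ₗ E ≪≫ₗ homDualEquiv hs⟩

end Nakayama

theorem stmt5 (k : Type u) [Field k]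
    (A B : Type u) [Ring A] [Ring B] [Algebra k A] [Algebra k B]
    [FiniteDimensional k A] [FiniteDimensional k B]
    (M : Type u) [AddCommGroup M]
    [Module B M] [Module Aᵐᵒᵖ M] [SMulCommClass B Aᵐᵒᵖ M] [SMulCommClass Aᵐᵒᵖ B M]
    (hM : IsFrobeniusBimodule B A M) :
    (∀ (X : Type u) (_ : AddCommGroup X) (_ : Module A X), Module.Finite A X →
      Nonempty
        ((((NCT A M X B) →ₗ[B] B) →ₗ[k] k) ≃ₗ[B]
          NCT A M (((X →ₗ[A] A) →ₗ[k] k)) B)) ∧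
    (∀ (Y : Type u) (_ : AddCommGroup Y) (_ : Module B Y), Module.Finite B Y →
      Nonempty
        ((((M →ₗ[B] Y) →ₗ[A] A) →ₗ[k] k) ≃ₗ[A]
          (M →ₗ[B] ((Y →ₗ[B] B) →ₗ[k] k)))) :=
  ⟨fun X _ _ _ => hM.nonempty_nakayama_tensor X, fun Y _ _ _ => hM.nonempty_nakayama_hom Y⟩
end
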